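/- Let G be a subcubic graph with a list assignment L with |L(e)| ≥ 10 for all edges, such that G is not strongly L-edge-colorable but every proper subgraph is. Then G contains no cycle of length 4. -/

import Mathlib

def StrongSees {V : Type*} (G : SimpleGraph V) (e e' : Sym2 V) : Prop :=
  (∃ v, v ∈ e ∧ v ∈ e') ∨ (∃ u v, u ∈ e ∧ v ∈ e' ∧ G.Adj u v)

def IsStrongEdgeColoring {V β : Type*} (G : SimpleGraph V) (c : Sym2 V → β) : Prop :=
  ∀ e ∈ G.edgeSet, ∀ e' ∈ G.edgeSet, e ≠ e' → StrongSees G e e' → c e ≠ c e'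

def StronglyListColorable {V β : Type*} (G : SimpleGraph V) (L : Sym2 V → Finset β) : Prop :=
  ∃ c : Sym2 V → β, IsStrongEdgeColoring G c ∧ ∀ e ∈ G.edgeSet, c e ∈ L e

def HC {ι β : Type*} [DecidableEq β] (s : Finset ι) (L : ι → Finset β) : Prop :=
  ∀ t, t ⊆ s → t.card ≤ (t.biUnion L).card

def good0 {n : ℕ} (s : Finset (Fin n)) (f : Fin n → ℕ) : Prop :=
  ∀ k ∈ Finset.range n, (s.filter (fun i => f i ≤ k)).card ≤ k

instance good0_dec {n : ℕ} (s : Finset (Fin n)) (f : Fin n → ℕ) : Decidable (good0 s f) := by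
  unfold good0; infer_instance

def ACol {ι β : Type*} (s : Finset ι) (L : ι → Finset β) (P : ι → ι → Prop) : Prop :=
  ∃ col : ι → β, (∀ i ∈ s, col i ∈ L i) ∧ ∀ i ∈ s, ∀ j ∈ s, i ≠ j → col i = col j → P i j

lemma HC_col {ι β : Type*} [DecidableEq ι] [DecidableEq β] [Nonempty β] (s : Finset ι) (L : ι → Finset β) (P : ι → ι → Prop)
    (h : HC s L) : ACol s L P := by
  have := (Finset.all_card_le_biUnion_card_iff_exists_injective
    (fun i : {x // x ∈ s} => L i.1)).1 (by
      intro t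
      have h1 := h (t.map ⟨Subtype.val, Subtype.val_injective⟩) (by
        intro x hx; simp at hx; exact hx.1)
      rw [Finset.card_map] at h1
      refine h1.trans (Finset.card_le_card ?_)
      intro x hx
      simp only [Finset.mem_biUnion, Finset.mem_map, Function.Embedding.coeFn_mk] at hx ⊢
      obtain ⟨a, ⟨b, hb, rfl⟩, hx⟩ := hx
      exact ⟨b, hb, hx⟩)
  obtain ⟨g, hg, hm⟩ := this
  refine ⟨fun i => if h : i ∈ s then g ⟨i, h⟩ else Classical.arbitrary β, ?_, ?_⟩
  · intro i hi
    simp only [hi, dif_pos]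
    exact hm ⟨i, hi⟩
  · intro i hi j hj hne heq
    simp only [hi, hj, dif_pos] at heq
    exact absurd (congrArg Subtype.val (hg heq)) hne

lemma HC_base {n : ℕ} {β : Type*} [DecidableEq β] (s : Finset (Fin n)) (L : Fin n → Finset β) (f : Fin n → ℕ)
    (hf : ∀ i ∈ s, f i ≤ (L i).card) (hg : good0 s f) : HC s L := by
  intro t ht
  by_contra hlt
  push Not at hlt
  have hall : ∀ i ∈ t, f i ≤ t.card - 1 := by
    intro i hi
    have h1 : (L i).card ≤ (t.biUnion L).card :=
      Finset.card_le_card (Finset.subset_biUnion_of_mem L hi)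
    have h2 := hf i (ht hi)
    have h3 : (t.biUnion (fun a => L a)).card < t.card := by convert hlt
    omega
  have hpos : 0 < t.card := by omega
  have hn : t.card ≤ n := by simpa using Finset.card_le_univ t
  have h4 := hg (t.card - 1) (by simp; omega)
  have h5 : t ⊆ s.filter (fun i => f i ≤ t.card - 1) := by
    intro i hi; simp [ht hi, hall i hi]
  have := Finset.card_le_card h5
  omega

lemma HC_pair {ι β : Type*} [DecidableEq ι] [DecidableEq β] (s : Finset ι) (L : ι → Finset β) (a b : ι)
    (h : s.card ≤ (L a ∪ L b).card) (ha : HC (s.erase a) L) (hb : HC (s.erase b) L) :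
    HC s L := by
  intro t ht
  by_cases h1 : a ∈ t
  · by_cases h2 : b ∈ t
    · refine (Finset.card_le_card ht).trans (h.trans (Finset.card_le_card ?_))
      exact Finset.union_subset (Finset.subset_biUnion_of_mem L h1)
        (Finset.subset_biUnion_of_mem L h2)
    · exact hb t (fun x hx => Finset.mem_erase.2 ⟨fun h => h2 (h ▸ hx), ht hx⟩)
  · exact ha t (fun x hx => Finset.mem_erase.2 ⟨fun h => h1 (h ▸ hx), ht hx⟩)

lemma ACol_share {ι β : Type*} [DecidableEq ι] [DecidableEq β] (s : Finset ι) (L : ι → Finset β) (P : ι → ι → Prop)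
    (hP : ∀ i j, P i j → P j i) (a b : ι) (hab : P a b) (d : β) (da : d ∈ L a) (db : d ∈ L b)
    (h : ACol ((s.erase a).erase b) (fun i => (L i).erase d) P) : ACol s L P := by
  obtain ⟨col, h1, h2⟩ := h
  have key : ∀ i ∈ s, ¬ (i = a ∨ i = b) → i ∈ (s.erase a).erase b := by
    intro i hi hn; push Not at hn; simp [hn, hi]
  refine ⟨fun i => if i = a ∨ i = b then d else col i, ?_, ?_⟩
  · intro i hi
    by_cases hc : i = a ∨ i = b
    · simp only [hc, if_true]; rcases hc with rfl | rfl <;> assumption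
    · simp only [hc, if_false]
      exact Finset.mem_of_mem_erase (h1 i (key i hi hc))
  · intro i hi j hj hne heq
    by_cases hc : i = a ∨ i = b <;> by_cases hd : j = a ∨ j = b
    · rcases hc with rfl | rfl <;> rcases hd with rfl | rfl
      · exact absurd rfl hne
      · exact hab
      · exact hP _ _ hab
      · exact absurd rfl hne
    · simp only [hc, hd, if_true, if_false] at heq
      have := h1 j (key j hj hd)
      rw [← heq] at this; simp at this
    · simp only [hc, hd, if_true, if_false] at heq
      have := h1 i (key i hi hc)
      rw [heq] at this; simp at this
    · simp only [hc, hd, if_false] at heq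
      exact h2 i (key i hi hc) j (key j hj hd) hne heq

lemma ACol_single {ι β : Type*} [DecidableEq ι] [DecidableEq β] (s : Finset ι) (L : ι → Finset β) (P : ι → ι → Prop)
    (a : ι) (d : β) (da : d ∈ L a)
    (h : ACol (s.erase a) (fun i => (L i).erase d) P) : ACol s L P := by
  obtain ⟨col, h1, h2⟩ := h
  have key : ∀ i ∈ s, ¬ (i = a) → i ∈ s.erase a := by
    intro i hi hn; simp [hn, hi]
  refine ⟨fun i => if i = a then d else col i, ?_, ?_⟩
  · intro i hi
    by_cases hc : i = a
    · simp only [hc, if_true]; exact da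
    · simp only [hc, if_false]
      exact Finset.mem_of_mem_erase (h1 i (key i hi hc))
  · intro i hi j hj hne heq
    by_cases hc : i = a <;> by_cases hd : j = a
    · exact absurd (hc.trans hd.symm) hne
    · simp only [hc, hd, if_true, if_false] at heq
      have := h1 j (key j hj hd)
      rw [← heq] at this; simp at this
    · simp only [hc, hd, if_true, if_false] at heq
      have := h1 i (key i hi hc)
      rw [heq] at this; simp at this
    · simp only [hc, hd, if_false] at heq
      exact h2 i (key i hi hc) j (key j hj hd) hne heq

def good1 {n : ℕ} (s : Finset (Fin n)) (f : Fin n → ℕ) (a b : Fin n) : Prop :=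
  s.card ≤ f a + f b ∧ good0 (s.erase a) f ∧ good0 (s.erase b) f

instance good1_dec {n : ℕ} (s : Finset (Fin n)) (f : Fin n → ℕ) (a b : Fin n) :
    Decidable (good1 s f a b) := by
  unfold good1; infer_instance

def test1 {n : ℕ} (s : Finset (Fin n)) (f : Fin n → ℕ) (a b : Fin n) : Prop :=
  good1 s f a b ∧ good0 ((s.erase a).erase b) (fun i => f i - 1) ∧ a ∈ s ∧ b ∈ s

instance test1_dec {n : ℕ} (s : Finset (Fin n)) (f : Fin n → ℕ) (a b : Fin n) :
    Decidable (test1 s f a b) := by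
  unfold test1; infer_instance

lemma erase_bd {ι β : Type*} [DecidableEq β] {s s' : Finset ι} {L : ι → Finset β} {f : ι → ℕ}
    (hs : s' ⊆ s) (hf : ∀ i ∈ s, f i ≤ (L i).card) (d : β) :
    ∀ i ∈ s', f i - 1 ≤ ((L i).erase d).card := by
  intro i hi
  have := Finset.pred_card_le_card_erase (s := L i) (a := d)
  have := hf i (hs hi)
  omega

lemma HC_good1 {n : ℕ} {β : Type*} [DecidableEq β] (s : Finset (Fin n)) (L : Fin n → Finset β) (f : Fin n → ℕ)
    (hf : ∀ i ∈ s, f i ≤ (L i).card) (a b : Fin n) (ha : a ∈ s) (hb : b ∈ s)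
    (hd : Disjoint (L a) (L b)) (hg : good1 s f a b) : HC s L := by
  obtain ⟨h1, h2, h3⟩ := hg
  apply HC_pair s L a b
  · rw [Finset.card_union_of_disjoint hd]
    have := hf a ha
    have := hf b hb
    omega
  · exact HC_base _ L f (fun i hi => hf i (Finset.mem_of_mem_erase hi)) (by convert h2)
  · exact HC_base _ L f (fun i hi => hf i (Finset.mem_of_mem_erase hi)) (by convert h3)

lemma ACol_test1 {n : ℕ} {β : Type*} [DecidableEq β] [Nonempty β] (s : Finset (Fin n)) (L : Fin n → Finset β)
    (f : Fin n → ℕ) (P : Fin n → Fin n → Prop) (hP : ∀ i j, P i j → P j i)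
    (hf : ∀ i ∈ s, f i ≤ (L i).card) (a b : Fin n) (hab : P a b) (h : test1 s f a b) :
    ACol s L P := by
  obtain ⟨h1, h2, ha, hb⟩ := h
  by_cases hd : Disjoint (L a) (L b)
  · exact HC_col _ _ _ (HC_good1 s L f hf a b ha hb hd h1)
  · rw [Finset.not_disjoint_iff] at hd
    obtain ⟨d, da, db⟩ := hd
    apply ACol_share s L P hP a b hab d da db
    apply HC_col
    apply HC_base _ _ (fun i => f i - 1)
    · apply erase_bd _ hf
      exact (Finset.erase_subset _ _).trans (Finset.erase_subset _ _)
    · convert h2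

def good2 {n : ℕ} (s : Finset (Fin n)) (f : Fin n → ℕ) (a b c d : Fin n) : Prop :=
  s.card ≤ f a + f b ∧ good1 (s.erase a) f c d ∧ good1 (s.erase b) f c d

instance good2_dec {n : ℕ} (s : Finset (Fin n)) (f : Fin n → ℕ) (a b c d : Fin n) :
    Decidable (good2 s f a b c d) := by
  unfold good2; infer_instance

def test2 {n : ℕ} (s : Finset (Fin n)) (f : Fin n → ℕ) (a b c d : Fin n) : Prop :=
  good2 s f a b c d ∧ good1 ((s.erase c).erase d) (fun i => f i - 1) a b ∧
  test1 ((s.erase a).erase b) (fun i => f i - 1) c d ∧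
  a ∈ (s.erase c).erase d ∧ b ∈ (s.erase c).erase d

instance test2_dec {n : ℕ} (s : Finset (Fin n)) (f : Fin n → ℕ) (a b c d : Fin n) :
    Decidable (test2 s f a b c d) := by
  unfold test2; infer_instance

lemma ACol_test2 {n : ℕ} {β : Type*} [DecidableEq β] [Nonempty β] (s : Finset (Fin n)) (L : Fin n → Finset β)
    (f : Fin n → ℕ) (P : Fin n → Fin n → Prop) (hP : ∀ i j, P i j → P j i)
    (hf : ∀ i ∈ s, f i ≤ (L i).card) (a b c d : Fin n) (hab : P a b) (hcd : P c d)
    (h : test2 s f a b c d) : ACol s L P := by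
  obtain ⟨h1, h2, h3, ha, hb⟩ := h
  have ha' := ha
  have hb' := hb
  simp only [Finset.mem_erase] at ha' hb'
  have hc : c ∈ s := by
    have := h3.2.2.1; simp only [Finset.mem_erase] at this; exact this.2.2
  have hdd : d ∈ s := by
    have := h3.2.2.2; simp only [Finset.mem_erase] at this; exact this.2.2
  by_cases hd : Disjoint (L a) (L b)
  · by_cases he : Disjoint (L c) (L d)
    · apply HC_col
      obtain ⟨g1, g2, g3⟩ := h1
      apply HC_pair s L a b
      · rw [Finset.card_union_of_disjoint hd]
        have := hf a ha'.2.2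
        have := hf b hb'.2.2
        omega
      · refine HC_good1 _ L f (fun i hi => hf i (Finset.mem_of_mem_erase hi)) c d ?_ ?_ he
          (by convert g2)
        · simp [hc]; exact fun h => ha'.2.1 h.symm
        · simp [hdd]; exact fun h => ha'.1 h.symm
      · refine HC_good1 _ L f (fun i hi => hf i (Finset.mem_of_mem_erase hi)) c d ?_ ?_ he
          (by convert g3)
        · simp [hc]; exact fun h => hb'.2.1 h.symm
        · simp [hdd]; exact fun h => hb'.1 h.symm
    · rw [Finset.not_disjoint_iff] at he
      obtain ⟨x, xc, xd⟩ := he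
      apply ACol_share s L P hP c d hcd x xc xd
      apply HC_col
      refine HC_good1 _ _ (fun i => f i - 1) ?_ a b (by convert ha) (by convert hb) ?_
        (by convert h2)
      · apply erase_bd _ hf
        exact (Finset.erase_subset _ _).trans (Finset.erase_subset _ _)
      · exact Finset.disjoint_of_subset_left (Finset.erase_subset _ _)
          (Finset.disjoint_of_subset_right (Finset.erase_subset _ _) hd)
  · rw [Finset.not_disjoint_iff] at hd
    obtain ⟨x, xa, xb⟩ := hd
    apply ACol_share s L P hP a b hab x xa xb
    refine ACol_test1 _ _ (fun i => f i - 1) P hP ?_ c d hcd (by convert h3)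
    apply erase_bd _ hf
    exact (Finset.erase_subset _ _).trans (Finset.erase_subset _ _)

/-- Items 0,1,2 may pairwise coincide; items 3,4 have a union of size at least 8. -/
lemma ACol_triple {β : Type*} [Nonempty β] (L : Fin 9 → Finset β) [DecidableEq β]
    (P : Fin 9 → Fin 9 → Prop) (hP : ∀ i j, P i j → P j i)
    (hf : ∀ i, [4,4,4,7,7,7,7,6,6].getD i.1 0 ≤ (L i).card)
    (h01 : P 0 1) (h02 : P 0 2) (h12 : P 1 2) (h34 : 8 ≤ (L 3 ∪ L 4).card) :
    ACol Finset.univ L P := by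
  set f : Fin 9 → ℕ := fun i => [4,4,4,7,7,7,7,6,6].getD i.1 0 with hfd
  have h34' : ∀ x, 7 ≤ ((L 3).erase x ∪ (L 4).erase x).card := by
    intro x
    rw [← Finset.erase_union_distrib]
    have := Finset.pred_card_le_card_erase (s := L 3 ∪ L 4) (a := x)
    have h9 : 8 ≤ (L 3 ∪ L 4).card := by convert h34
    omega
  have share : ∀ a b : Fin 9, P a b →
      ((Finset.univ.erase a).erase b).card ≤ 7 →
      good0 ((((Finset.univ : Finset (Fin 9)).erase a).erase b).erase 3) (fun i => f i - 1) →
      good0 ((((Finset.univ : Finset (Fin 9)).erase a).erase b).erase 4) (fun i => f i - 1) →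
      ¬ Disjoint (L a) (L b) → ACol Finset.univ L P := by
    intro a b hab hc hg3 hg4 hd
    rw [Finset.not_disjoint_iff] at hd
    obtain ⟨x, xa, xb⟩ := hd
    apply ACol_share _ L P hP a b hab x xa xb
    apply HC_col
    have hbd : ∀ i, f i - 1 ≤ ((L i).erase x).card := fun i =>
      erase_bd (s := Finset.univ) (s' := Finset.univ) subset_rfl (fun i _ => hf i) x i (by simp)
    refine HC_pair _ _ 3 4 ?_ ?_ ?_
    · refine le_trans ?_ (h34' x)
      convert hc
    · exact HC_base _ _ (fun i => f i - 1) (fun i _ => hbd i) (by convert hg3)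
    · exact HC_base _ _ (fun i => f i - 1) (fun i _ => hbd i) (by convert hg4)
  by_cases d01 : Disjoint (L 0) (L 1)
  swap
  · exact share 0 1 h01 (by decide) (by decide) (by decide) d01
  by_cases d02 : Disjoint (L 0) (L 2)
  swap
  · exact share 0 2 h02 (by decide) (by decide) (by decide) d02
  by_cases d12 : Disjoint (L 1) (L 2)
  swap
  · exact share 1 2 h12 (by decide) (by decide) (by decide) d12
  have h2 := hf 2
  have hne : (L 2).Nonempty := by
    rw [← Finset.card_pos]; simp at h2; omega
  obtain ⟨x, hx⟩ := hne
  have hx0 : x ∉ L 0 := fun h => Finset.disjoint_left.1 d02 h hx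
  have hx1 : x ∉ L 1 := fun h => Finset.disjoint_left.1 d12 h hx
  apply ACol_single _ L P 2 x hx
  apply HC_col
  have hbd : ∀ i, [4,4,4,6,6,6,6,5,5].getD i.1 0 - (if i = 2 then 1 else 0)
      ≤ ((L i).erase x).card := by
    intro i
    have h0 := erase_bd (s := Finset.univ) (s' := Finset.univ) subset_rfl (fun i _ => hf i) x i
      (by simp)
    have e0 : (L 0).erase x = L 0 := Finset.erase_eq_of_notMem hx0
    have e1 : (L 1).erase x = L 1 := Finset.erase_eq_of_notMem hx1
    have b0 := hf 0
    have b1 := hf 1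
    fin_cases i <;> simp [hfd] at * <;> simp_all
  have key : ∀ u : Fin 9, good0 ((((Finset.univ : Finset (Fin 9)).erase 2).erase u).erase 3)
      (fun i => [4,4,4,6,6,6,6,5,5].getD i.1 0 - (if i = 2 then 1 else 0)) →
      good0 ((((Finset.univ : Finset (Fin 9)).erase 2).erase u).erase 4)
      (fun i => [4,4,4,6,6,6,6,5,5].getD i.1 0 - (if i = 2 then 1 else 0)) →
      (((Finset.univ : Finset (Fin 9)).erase 2).erase u).card ≤ 7 →
      HC (((Finset.univ : Finset (Fin 9)).erase 2).erase u) (fun i => (L i).erase x) := by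
    intro u g3 g4 hc
    refine HC_pair _ _ 3 4 ?_ ?_ ?_
    · refine le_trans ?_ (h34' x)
      convert hc
    · exact HC_base _ _ _ (fun i _ => hbd i) (by convert g3)
    · exact HC_base _ _ _ (fun i _ => hbd i) (by convert g4)
  refine HC_pair _ _ 0 1 ?_ ?_ ?_
  · have e0 : (L 0).erase x = L 0 := Finset.erase_eq_of_notMem hx0
    have e1 : (L 1).erase x = L 1 := Finset.erase_eq_of_notMem hx1
    have b0 := hf 0
    have b1 := hf 1
    simp only [e0, e1]
    rw [Finset.card_union_of_disjoint d01]
    simp at b0 b1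
    simp
    omega
  · convert key 0 (by decide) (by decide) (by decide)
  · convert key 1 (by decide) (by decide) (by decide)
def PCol {V β : Type*} (G : SimpleGraph V) (L : Sym2 V → Finset β) (U : Set (Sym2 V))
    (c : Sym2 V → β) : Prop :=
  (∀ e ∈ G.edgeSet, ∀ f ∈ G.edgeSet, e ∉ U → f ∉ U → e ≠ f → StrongSees G e f → c e ≠ c f) ∧
  ∀ e ∈ G.edgeSet, e ∉ U → c e ∈ L e

lemma PCol.mono {V β : Type*} {G : SimpleGraph V} {L : Sym2 V → Finset β} {U U' : Set (Sym2 V)}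
    {c : Sym2 V → β} (h : PCol G L U c) (hU : ∀ e ∈ G.edgeSet, e ∈ U → e ∈ U') :
    PCol G L U' c :=
  ⟨fun e he f hf heU hfU => h.1 e he f hf (fun h => heU (hU e he h)) (fun h => hfU (hU f hf h)),
   fun e he heU => h.2 e he (fun h => heU (hU e he h))⟩

open Classical in
noncomputable def res {V β : Type*} (G : SimpleGraph V) (L : Sym2 V → Finset β) (U : Set (Sym2 V))
    (c : Sym2 V → β) (e : Sym2 V) : Finset β :=
  (L e).filter (fun x => ∀ f ∈ G.edgeSet, f ∉ U → StrongSees G e f → c f ≠ x)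

open Classical in
noncomputable def Kc {V β : Type*} [Fintype V] (G : SimpleGraph V) (U : Set (Sym2 V))
    (c : Sym2 V → β) (w : V) : Finset β :=
  (Finset.univ.filter (fun z => G.Adj w z ∧ s(w, z) ∉ U)).image (fun z => c s(w, z))

def nb {V : Type*} (G : SimpleGraph V) (a p q r : V) : Prop :=
  ∀ w, G.Adj a w → w = p ∨ w = q ∨ w = r

lemma sees_symm {V : Type*} {G : SimpleGraph V} {e f : Sym2 V} (h : StrongSees G e f) :
    StrongSees G f e := by
  rcases h with ⟨v, h1, h2⟩ | ⟨u, v, h1, h2, h3⟩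
  · exact Or.inl ⟨v, h2, h1⟩
  · exact Or.inr ⟨v, u, h2, h1, h3.symm⟩

def NC {V : Type*} (G : SimpleGraph V) (e f : Sym2 V) : Prop :=
  ¬ (e ∈ G.edgeSet ∧ f ∈ G.edgeSet ∧ StrongSees G e f)

lemma NC_symm {V : Type*} {G : SimpleGraph V} {e f : Sym2 V} (h : NC G e f) : NC G f e :=
  fun ⟨h1, h2, h3⟩ => h ⟨h2, h1, sees_symm h3⟩

lemma NC_mk {V : Type*} {G : SimpleGraph V} {a b p q : V}
    (h : G.Adj a b → G.Adj p q → a ≠ p ∧ a ≠ q ∧ b ≠ p ∧ b ≠ q ∧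
      ¬ G.Adj a p ∧ ¬ G.Adj a q ∧ ¬ G.Adj b p ∧ ¬ G.Adj b q) : NC G s(a, b) s(p, q) := by
  rintro ⟨h1, h2, h3⟩
  obtain ⟨g1, g2, g3, g4, g5, g6, g7, g8⟩ := h h1 h2
  rcases h3 with ⟨v, k1, k2⟩ | ⟨u, v, k1, k2, k3⟩
  · rw [Sym2.mem_iff] at k1 k2
    rcases k1 with rfl | rfl <;> rcases k2 with rfl | rfl <;> contradiction
  · rw [Sym2.mem_iff] at k1 k2
    rcases k1 with rfl | rfl <;> rcases k2 with rfl | rfl <;> contradiction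

lemma Kc_mem {V β : Type*} [Fintype V] {G : SimpleGraph V} {U : Set (Sym2 V)}
    {c : Sym2 V → β} {w z : V} (h : G.Adj w z) (hU : s(w, z) ∉ U) : c s(w, z) ∈ Kc G U c w := by
  classical
  unfold Kc
  rw [Finset.mem_image]
  exact ⟨z, by simp [h, hU], rfl⟩

lemma Kc_bd {V β : Type*} [Fintype V] {G : SimpleGraph V} {U : Set (Sym2 V)}
    {c : Sym2 V → β} {w : V} (S : List V) (h : ∀ z, G.Adj w z → s(w, z) ∉ U → z ∈ S) :
    (Kc G U c w).card ≤ S.length := by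
  classical
  calc (Kc G U c w).card ≤ (S.toFinset.image (fun z => c s(w, z))).card := by
        apply Finset.card_le_card
        unfold Kc
        intro x hx
        rw [Finset.mem_image] at hx ⊢
        obtain ⟨z, hz, rfl⟩ := hx
        simp only [Finset.mem_filter, Finset.mem_univ, true_and] at hz
        exact ⟨z, by simpa using h z hz.1 hz.2, rfl⟩
    _ ≤ S.toFinset.card := Finset.card_image_le
    _ ≤ S.length := List.toFinset_card_le S

lemma K2 {V β : Type*} [Fintype V] {G : SimpleGraph V} {U : Set (Sym2 V)}
    {c : Sym2 V → β} {w p q r : V} (h : nb G w p q r) (h1 : s(w, p) ∈ U) :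
    (Kc G U c w).card ≤ 2 := by
  refine Kc_bd [q, r] ?_
  intro z hz hu
  rcases h z hz with rfl | rfl | rfl
  · exact absurd h1 hu
  · simp
  · simp

lemma K1 {V β : Type*} [Fintype V] {G : SimpleGraph V} {U : Set (Sym2 V)}
    {c : Sym2 V → β} {w p q r : V} (h : nb G w p q r) (h1 : s(w, p) ∈ U) (h2 : s(w, q) ∈ U) :
    (Kc G U c w).card ≤ 1 := by
  refine Kc_bd [r] ?_
  intro z hz hu
  rcases h z hz with rfl | rfl | rfl
  · exact absurd h1 hu
  · exact absurd h2 hu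
  · simp

lemma K0 {V β : Type*} [Fintype V] {G : SimpleGraph V} {U : Set (Sym2 V)}
    {c : Sym2 V → β} {w p q r : V} (h : nb G w p q r) (h1 : s(w, p) ∈ U) (h2 : s(w, q) ∈ U)
    (h3 : G.Adj w r → s(w, r) ∈ U) :
    (Kc G U c w).card ≤ 0 := by
  refine Kc_bd [] ?_
  intro z hz hu
  rcases h z hz with rfl | rfl | rfl
  · exact absurd h1 hu
  · exact absurd h2 hu
  · exact absurd (h3 hz) hu

lemma res_bd {V β : Type*} [Fintype V] {G : SimpleGraph V} {L : Sym2 V → Finset β}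
    {U : Set (Sym2 V)} {c : Sym2 V → β} (hL : ∀ e, 10 ≤ (L e).card)
    {a b a1 a2 b1 b2 : V} (ha : nb G a b a1 a2) (hb : nb G b a b1 b2)
    (hU : G.Adj a b → s(a, b) ∈ U) {k1 k2 k3 k4 : ℕ}
    (h1 : (Kc G U c a1).card ≤ k1) (h2 : (Kc G U c a2).card ≤ k2)
    (h3 : (Kc G U c b1).card ≤ k3) (h4 : (Kc G U c b2).card ≤ k4) :
    10 ≤ (res G L U c s(a, b)).card + (k1 + k2 + k3 + k4) := by
  classical
  have key : L s(a, b) ⊆ res G L U c s(a, b) ∪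
      (Kc G U c a1 ∪ Kc G U c a2 ∪ (Kc G U c b1 ∪ Kc G U c b2)) := by
    intro x hx
    by_cases hr : x ∈ res G L U c s(a, b)
    · exact Finset.mem_union_left _ hr
    · apply Finset.mem_union_right
      unfold res at hr
      simp only [Finset.mem_filter, hx, true_and, not_forall] at hr
      obtain ⟨f, hf, hfU, hs, hcx⟩ := hr
      rw [not_not] at hcx
      subst hcx
      have hKa : ∀ p q, G.Adj p q → s(p, q) ∉ U → p = a1 ∨ p = a2 ∨ p = b1 ∨ p = b2 →
          c s(p, q) ∈ Kc G U c a1 ∪ Kc G U c a2 ∪ (Kc G U c b1 ∪ Kc G U c b2) := by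
        intro p q hpq hu hor
        have := Kc_mem (c := c) hpq hu
        simp only [Finset.mem_union]
        rcases hor with rfl | rfl | rfl | rfl <;> tauto
      have hKx : ∀ p q, G.Adj p q → s(p, q) ∉ U →
          (p = a1 ∨ p = a2 ∨ p = b1 ∨ p = b2) ∨ p = a ∨ p = b →
          c s(p, q) ∈ Kc G U c a1 ∪ Kc G U c a2 ∪ (Kc G U c b1 ∪ Kc G U c b2) := by
        intro p q hpq hu hor
        rcases hor with hor | rfl | rfl
        · exact hKa p q hpq hu hor
        · rcases ha q hpq with rfl | h | h
          · exact absurd (hU hpq) hu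
          · rw [Sym2.eq_swap]
            exact hKa q p hpq.symm (by rwa [Sym2.eq_swap]) (by tauto)
          · rw [Sym2.eq_swap]
            exact hKa q p hpq.symm (by rwa [Sym2.eq_swap]) (by tauto)
        · rcases hb q hpq with rfl | h | h
          · exact absurd (hU hpq.symm) (by rwa [Sym2.eq_swap])
          · rw [Sym2.eq_swap]
            exact hKa q p hpq.symm (by rwa [Sym2.eq_swap]) (by tauto)
          · rw [Sym2.eq_swap]
            exact hKa q p hpq.symm (by rwa [Sym2.eq_swap]) (by tauto)
      have hmem : ∃ p, p ∈ f ∧ ((p = a1 ∨ p = a2 ∨ p = b1 ∨ p = b2) ∨ p = a ∨ p = b) := by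
        rcases hs with ⟨v, k1, k2⟩ | ⟨u, v, k1, k2, k3⟩
        · rw [Sym2.mem_iff] at k1
          exact ⟨v, k2, Or.inr k1⟩
        · refine ⟨v, k2, ?_⟩
          rw [Sym2.mem_iff] at k1
          rcases k1 with rfl | rfl
          · have := ha v k3; tauto
          · have := hb v k3; tauto
      obtain ⟨p, hp, hor⟩ := hmem
      obtain ⟨q, rfl⟩ := Sym2.mem_iff_exists.1 hp
      exact hKx p q hf hfU hor
  have c1 := Finset.card_le_card key
  have c2 := Finset.card_union_le (res G L U c s(a, b))
    (Kc G U c a1 ∪ Kc G U c a2 ∪ (Kc G U c b1 ∪ Kc G U c b2))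
  have c3 := Finset.card_union_le (Kc G U c a1 ∪ Kc G U c a2) (Kc G U c b1 ∪ Kc G U c b2)
  have c4 := Finset.card_union_le (Kc G U c a1) (Kc G U c a2)
  have c5 := Finset.card_union_le (Kc G U c b1) (Kc G U c b2)
  have := hL s(a, b)
  omega

lemma ext_core {V β : Type*} {G : SimpleGraph V} {L : Sym2 V → Finset β}
    {c : Sym2 V → β} (l : List (Sym2 V)) (hnd : l.Nodup) (hpc : PCol G L {e | e ∈ l} c)
    (h : ACol (Finset.univ : Finset (Fin l.length)) (fun i => res G L {e | e ∈ l} c (l.get i))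
      (fun i j => NC G (l.get i) (l.get j))) : StronglyListColorable G L := by
  classical
  obtain ⟨col, h1, h2⟩ := h
  have hinj : Function.Injective l.get := List.nodup_iff_injective_get.1 hnd
  have hget : ∀ e ∈ l, ∃ i, l.get i = e := fun e he => List.mem_iff_get.1 he
  have hr : ∀ i, col i ∈ L (l.get i) ∧ ∀ f ∈ G.edgeSet, f ∉ l → StrongSees G (l.get i) f →
      c f ≠ col i := by
    intro i
    have := h1 i (Finset.mem_univ _)
    unfold res at this
    exact Finset.mem_filter.1 this
  have hnot : ∀ e, e ∉ l → ¬ ∃ i, l.get i = e := by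
    rintro e he ⟨i, rfl⟩
    exact he (List.get_mem _ _)
  refine ⟨Function.extend l.get col c, ?_, ?_⟩
  · intro e he f hf hne hs
    by_cases hel : e ∈ l <;> by_cases hfl : f ∈ l
    · obtain ⟨i, rfl⟩ := hget e hel
      obtain ⟨j, rfl⟩ := hget f hfl
      rw [hinj.extend_apply, hinj.extend_apply]
      intro heq
      exact h2 i (Finset.mem_univ _) j (Finset.mem_univ _) (fun h => hne (by rw [h])) heq
        ⟨he, hf, hs⟩
    · obtain ⟨i, rfl⟩ := hget e hel
      rw [hinj.extend_apply, Function.extend_apply' _ _ _ (hnot f hfl)]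
      exact ((hr i).2 f hf hfl hs).symm
    · obtain ⟨i, rfl⟩ := hget f hfl
      rw [hinj.extend_apply, Function.extend_apply' _ _ _ (hnot e hel)]
      exact (hr i).2 e he hel (sees_symm hs)
    · rw [Function.extend_apply' _ _ _ (hnot e hel), Function.extend_apply' _ _ _ (hnot f hfl)]
      exact hpc.1 e he f hf hel hfl hne hs
  · intro e he
    by_cases hel : e ∈ l
    · obtain ⟨i, rfl⟩ := hget e hel
      rw [hinj.extend_apply]
      exact (hr i).1
    · rw [Function.extend_apply' _ _ _ (hnot e hel)]
      exact hpc.2 e he hel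

lemma fl_bd {α : Type*} {F : α → ℕ} {l : List α} {fl : List ℕ}
    (hb : List.Forall₂ (fun e k => k ≤ F e) l fl) (i : Fin l.length) :
    fl.getD i.1 0 ≤ F (l.get i) := by
  have h1 := hb.length_eq
  have h2 := (List.forall₂_iff_get.1 hb).2 i.1 i.2 (h1 ▸ i.2)
  rw [List.getD_eq_getElem _ _ (h1 ▸ i.2)]
  exact h2

lemma ext0 {V β : Type*} [Nonempty β] {G : SimpleGraph V} {L : Sym2 V → Finset β}
    {c : Sym2 V → β} (l : List (Sym2 V)) (fl : List ℕ) (n : ℕ) (hn : l.length = n)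
    (hnd : l.Nodup) (hpc : PCol G L {e | e ∈ l} c)
    (hb : List.Forall₂ (fun e k => k ≤ (res G L {e | e ∈ l} c e).card) l fl)
    (ht : good0 (Finset.univ : Finset (Fin n)) (fun i => fl.getD i.1 0)) :
    StronglyListColorable G L := by
  classical
  subst hn
  apply ext_core l hnd hpc
  apply HC_col
  exact HC_base _ _ _ (fun i _ => fl_bd hb i) ht

lemma ext1 {V β : Type*} [Nonempty β] {G : SimpleGraph V} {L : Sym2 V → Finset β}
    {c : Sym2 V → β} (e1 e2 : Sym2 V) (l' l : List (Sym2 V)) (hl : l = e1 :: e2 :: l')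
    (fl : List ℕ) (n : ℕ)
    (hn : l'.length = n) (hnd : l.Nodup) (hpc : PCol G L {e | e ∈ l} c)
    (hb : List.Forall₂ (fun e k => k ≤ (res G L {e | e ∈ l} c e).card) l fl)
    (h12 : NC G e1 e2)
    (ht : test1 (Finset.univ : Finset (Fin (n + 2))) (fun i => fl.getD i.1 0) 0 1) :
    StronglyListColorable G L := by
  classical
  subst hn
  subst hl
  apply ext_core _ hnd hpc
  exact ACol_test1 _ _ _ _ (fun _ _ h => NC_symm h) (fun i _ => fl_bd hb i)
    (0 : Fin (l'.length + 2)) (1 : Fin (l'.length + 2)) h12 ht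

lemma ext2 {V β : Type*} [Nonempty β] {G : SimpleGraph V} {L : Sym2 V → Finset β}
    {c : Sym2 V → β} (e1 e2 e3 e4 : Sym2 V) (l' l : List (Sym2 V))
    (hl : l = e1 :: e2 :: e3 :: e4 :: l') (fl : List ℕ) (n : ℕ)
    (hn : l'.length = n) (hnd : l.Nodup) (hpc : PCol G L {e | e ∈ l} c)
    (hb : List.Forall₂ (fun e k => k ≤ (res G L {e | e ∈ l} c e).card) l fl)
    (h12 : NC G e1 e2) (h34 : NC G e3 e4)
    (ht : test2 (Finset.univ : Finset (Fin (n + 4))) (fun i => fl.getD i.1 0) 0 1 2 3) :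
    StronglyListColorable G L := by
  classical
  subst hn
  subst hl
  apply ext_core _ hnd hpc
  exact ACol_test2 _ _ _ _ (fun _ _ h => NC_symm h) (fun i _ => fl_bd hb i)
    (0 : Fin (l'.length + 4)) (1 : Fin (l'.length + 4)) (2 : Fin (l'.length + 4))
    (3 : Fin (l'.length + 4)) h12 h34 ht

lemma ext3 {V β : Type*} [Nonempty β] [DecidableEq β] {G : SimpleGraph V} {L : Sym2 V → Finset β}
    {c : Sym2 V → β} (e0 e1 e2 e3 e4 e5 e6 e7 e8 : Sym2 V) (l : List (Sym2 V))
    (hl : l = [e0, e1, e2, e3, e4, e5, e6, e7, e8])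
    (hnd : l.Nodup) (hpc : PCol G L {e | e ∈ l} c)
    (hb : List.Forall₂ (fun e k => k ≤ (res G L {e | e ∈ l} c e).card) l [4,4,4,7,7,7,7,6,6])
    (h01 : NC G e0 e1) (h02 : NC G e0 e2) (h12 : NC G e1 e2)
    (h34 : 8 ≤ (res G L {e | e ∈ l} c e3 ∪ res G L {e | e ∈ l} c e4).card) :
    StronglyListColorable G L := by
  subst hl
  apply ext_core _ hnd hpc
  exact ACol_triple _ _ (fun _ _ h => NC_symm h) (fun i => fl_bd hb i) h01 h02 h12 h34
/-- A 4-cycle together with the third neighbours (or dummy self-references). -/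
structure Cfg {V : Type*} (G : SimpleGraph V) (v1 v2 v3 v4 u1 u2 u3 u4 : V) : Prop where
  a12 : G.Adj v1 v2
  a23 : G.Adj v2 v3
  a34 : G.Adj v3 v4
  a41 : G.Adj v4 v1
  n13 : v1 ≠ v3
  n24 : v2 ≠ v4
  b1 : nb G v1 v2 v4 u1
  b2 : nb G v2 v1 v3 u2
  b3 : nb G v3 v2 v4 u3
  b4 : nb G v4 v1 v3 u4
  p1 : G.Adj v1 u1 ∨ u1 = v1
  p2 : G.Adj v2 u2 ∨ u2 = v2
  p3 : G.Adj v3 u3 ∨ u3 = v3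
  p4 : G.Adj v4 u4 ∨ u4 = v4
  q12 : u1 ≠ v2
  q14 : u1 ≠ v4
  q21 : u2 ≠ v1
  q23 : u2 ≠ v3
  q32 : u3 ≠ v2
  q34 : u3 ≠ v4
  q41 : u4 ≠ v1
  q43 : u4 ≠ v3

lemma Cfg.ne {V : Type*} {G : SimpleGraph V} {v1 v2 v3 v4 u1 u2 u3 u4 : V}
    (C : Cfg G v1 v2 v3 v4 u1 u2 u3 u4) : v1 ≠ v2 ∧ v2 ≠ v3 ∧ v3 ≠ v4 ∧ v4 ≠ v1 :=
  ⟨C.a12.ne, C.a23.ne, C.a34.ne, C.a41.ne⟩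

lemma nb.sw {V : Type*} {G : SimpleGraph V} {a p q r : V} (h : nb G a p q r) : nb G a q p r :=
  fun w hw => by have := h w hw; tauto

lemma nb.rt {V : Type*} {G : SimpleGraph V} {a p q r : V} (h : nb G a p q r) : nb G a r p q :=
  fun w hw => by have := h w hw; tauto

lemma Cfg.rot {V : Type*} {G : SimpleGraph V} {v1 v2 v3 v4 u1 u2 u3 u4 : V}
    (C : Cfg G v1 v2 v3 v4 u1 u2 u3 u4) : Cfg G v2 v3 v4 v1 u2 u3 u4 u1 :=
  ⟨C.a23, C.a34, C.a41, C.a12, C.n24, C.n13.symm, C.b2.sw, C.b3, C.b4.sw, C.b1, C.p2, C.p3, C.p4,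
    C.p1, C.q23, C.q21, C.q32, C.q34, C.q43, C.q41, C.q12, C.q14⟩

lemma Cfg.refl {V : Type*} {G : SimpleGraph V} {v1 v2 v3 v4 u1 u2 u3 u4 : V}
    (C : Cfg G v1 v2 v3 v4 u1 u2 u3 u4) : Cfg G v1 v4 v3 v2 u1 u4 u3 u2 :=
  ⟨C.a41.symm, C.a34.symm, C.a23.symm, C.a12.symm, C.n13, C.n24.symm, C.b1.sw, C.b4, C.b3.sw, C.b2,
    C.p1, C.p4, C.p3, C.p2, C.q14, C.q12, C.q41, C.q43, C.q34, C.q32, C.q21, C.q23⟩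

def Tch {V : Type*} (v1 v2 v3 v4 : V) : Set (Sym2 V) :=
  {e | v1 ∈ e ∨ v2 ∈ e ∨ v3 ∈ e ∨ v4 ∈ e}

lemma Tch_rot {V : Type*} (v1 v2 v3 v4 : V) : Tch v2 v3 v4 v1 = Tch v1 v2 v3 v4 := by
  ext e; simp only [Tch, Set.mem_ofPred_eq]; tauto

lemma Tch_refl {V : Type*} (v1 v2 v3 v4 : V) : Tch v1 v4 v3 v2 = Tch v1 v2 v3 v4 := by
  ext e; simp only [Tch, Set.mem_ofPred_eq]; tauto

def l8 {V : Type*} (v1 v2 v3 v4 u1 u2 u3 u4 : V) : List (Sym2 V) :=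
  [s(v1, v2), s(v2, v3), s(v3, v4), s(v4, v1), s(v1, u1), s(v2, u2), s(v3, u3), s(v4, u4)]

lemma Cfg.t1 {V : Type*} {G : SimpleGraph V} {v1 v2 v3 v4 u1 u2 u3 u4 : V}
    (C : Cfg G v1 v2 v3 v4 u1 u2 u3 u4) (e : Sym2 V) (he : e ∈ G.edgeSet) (h : v1 ∈ e) :
    e = s(v1, v2) ∨ e = s(v4, v1) ∨ e = s(v1, u1) := by
  obtain ⟨w, rfl⟩ := Sym2.mem_iff_exists.1 h
  rcases C.b1 w he with rfl | rfl | rfl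
  · simp
  · right; left; rw [Sym2.eq_swap]
  · simp

lemma Cfg.touch {V : Type*} {G : SimpleGraph V} {v1 v2 v3 v4 u1 u2 u3 u4 : V}
    (C : Cfg G v1 v2 v3 v4 u1 u2 u3 u4) (e : Sym2 V) (he : e ∈ G.edgeSet)
    (h : e ∈ Tch v1 v2 v3 v4) : e ∈ l8 v1 v2 v3 v4 u1 u2 u3 u4 := by
  unfold l8
  simp only [List.mem_cons, List.not_mem_nil, or_false]
  rcases h with h | h | h | h
  · have := C.t1 e he h; tauto
  · have := C.rot.t1 e he h; tauto
  · have := C.rot.rot.t1 e he h; tauto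
  · have := C.rot.rot.rot.t1 e he h; tauto

/-- everything we carry around -/
structure Ctx {V β : Type*} [Fintype V] (G : SimpleGraph V) (L : Sym2 V → Finset β)
    (c : Sym2 V → β) (v1 v2 v3 v4 u1 u2 u3 u4 : V) : Prop where
  C : Cfg G v1 v2 v3 v4 u1 u2 u3 u4
  hL : ∀ e, 10 ≤ (L e).card
  pc : PCol G L (Tch v1 v2 v3 v4) c
  D1 : ∀ a p, G.Adj a p → ∃ q r, nb G a p q r
  D2 : ∀ a p q, G.Adj a p → G.Adj a q → p ≠ q →
    ∃ r, nb G a p q r ∧ (G.Adj a r ∨ r = a) ∧ r ≠ p ∧ r ≠ q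
  D3 : ∀ a p q r, G.Adj a p → G.Adj a q → G.Adj a r → p ≠ q → p ≠ r → q ≠ r → nb G a p q r
  K3 : ∀ (U : Set (Sym2 V)) (c : Sym2 V → β) (a : V), (Kc G U c a).card ≤ 3

section
variable {V β : Type*} [Fintype V] {G : SimpleGraph V} {L : Sym2 V → Finset β}
    {c : Sym2 V → β} {v1 v2 v3 v4 u1 u2 u3 u4 : V}

lemma Ctx.rot (X : Ctx G L c v1 v2 v3 v4 u1 u2 u3 u4) : Ctx G L c v2 v3 v4 v1 u2 u3 u4 u1 :=
  ⟨X.C.rot, X.hL, by rw [Tch_rot]; exact X.pc, X.D1, X.D2, X.D3, X.K3⟩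

lemma Ctx.refl (X : Ctx G L c v1 v2 v3 v4 u1 u2 u3 u4) : Ctx G L c v1 v4 v3 v2 u1 u4 u3 u2 :=
  ⟨X.C.refl, X.hL, by rw [Tch_refl]; exact X.pc, X.D1, X.D2, X.D3, X.K3⟩

lemma Ctx.nonempty (_ : Ctx G L c v1 v2 v3 v4 u1 u2 u3 u4) : Nonempty β := ⟨c s(v1, v2)⟩

/-- the extra set U contains all edges touching the cycle -/
def Full (G : SimpleGraph V) (v1 v2 v3 v4 : V) (U : Set (Sym2 V)) : Prop :=
  ∀ e ∈ G.edgeSet, e ∈ Tch v1 v2 v3 v4 → e ∈ U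

lemma Full.rot {U : Set (Sym2 V)} (h : Full G v1 v2 v3 v4 U) : Full G v2 v3 v4 v1 U := by
  unfold Full; rw [Tch_rot]; exact h

lemma Full.refl {U : Set (Sym2 V)} (h : Full G v1 v2 v3 v4 U) : Full G v1 v4 v3 v2 U := by
  unfold Full; rw [Tch_refl]; exact h

lemma Ctx.full (X : Ctx G L c v1 v2 v3 v4 u1 u2 u3 u4) (l : List (Sym2 V))
    (h : ∀ e ∈ l8 v1 v2 v3 v4 u1 u2 u3 u4, e ∈ l) : Full G v1 v2 v3 v4 {e | e ∈ l} :=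
  fun e he ht => h e (X.C.touch e he ht)

lemma Ctx.pcU (X : Ctx G L c v1 v2 v3 v4 u1 u2 u3 u4) {U : Set (Sym2 V)}
    (hU : Full G v1 v2 v3 v4 U) : PCol G L U c := X.pc.mono hU

lemma Kv1 {U : Set (Sym2 V)} (hU : Full G v1 v2 v3 v4 U) : (Kc G U c v1).card ≤ 0 := by
  refine Kc_bd [] ?_
  intro z hz hu
  exact absurd (hU _ hz (by left; simp)) hu

lemma Ctx.cb12 (X : Ctx G L c v1 v2 v3 v4 u1 u2 u3 u4) {d : Sym2 V → β} {U : Set (Sym2 V)}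
    (hU : Full G v1 v2 v3 v4 U) {k1 k2 : ℕ} (h1 : (Kc G U d u1).card ≤ k1)
    (h2 : (Kc G U d u2).card ≤ k2) : 10 ≤ (res G L U d s(v1, v2)).card + (k1 + k2) := by
  have := res_bd (U := U) (c := d) X.hL X.C.b1 X.C.b2 (fun h => hU _ h (by left; simp))
    (Kv1 hU.rot.rot.rot) h1 (Kv1 hU.rot.rot) h2
  omega

lemma Ctx.cbs (X : Ctx G L c v1 v2 v3 v4 u1 u2 u3 u4) {d : Sym2 V → β} {U : Set (Sym2 V)}
    (hU : Full G v1 v2 v3 v4 U) {k1 k2 k3 k4 : ℕ} (h1 : (Kc G U d u1).card ≤ k1)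
    (h2 : (Kc G U d u2).card ≤ k2) (h3 : (Kc G U d u3).card ≤ k3)
    (h4 : (Kc G U d u4).card ≤ k4) :
    10 ≤ (res G L U d s(v1, v2)).card + (k1 + k2) ∧
    10 ≤ (res G L U d s(v2, v3)).card + (k2 + k3) ∧
    10 ≤ (res G L U d s(v3, v4)).card + (k3 + k4) ∧
    10 ≤ (res G L U d s(v4, v1)).card + (k4 + k1) :=
  ⟨X.cb12 hU h1 h2, X.rot.cb12 hU.rot h2 h3, X.rot.rot.cb12 hU.rot.rot h3 h4,
    X.rot.rot.rot.cb12 hU.rot.rot.rot h4 h1⟩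

lemma Ctx.pb (X : Ctx G L c v1 v2 v3 v4 u1 u2 u3 u4) {d : Sym2 V → β} {U : Set (Sym2 V)}
    (hU : Full G v1 v2 v3 v4 U) {q r : V} (hn : nb G u1 v1 q r) {k1 k2 : ℕ}
    (h1 : (Kc G U d q).card ≤ k1) (h2 : (Kc G U d r).card ≤ k2) :
    10 ≤ (res G L U d s(v1, u1)).card + (k1 + k2) := by
  have := res_bd (U := U) (c := d) X.hL X.C.b1.rt hn (fun h => hU _ h (by left; simp))
    (Kv1 hU.rot) (Kv1 hU.rot.rot.rot) h1 h2
  omega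

lemma Ctx.nbu (X : Ctx G L c v1 v2 v3 v4 u1 u2 u3 u4) : ∃ q r, nb G u1 v1 q r := by
  rcases X.C.p1 with h | h
  · exact X.D1 _ _ h.symm
  · rw [h]
    have := X.C.b1.rt
    rw [h] at this
    exact ⟨_, _, this⟩

lemma Ctx.pb4 (X : Ctx G L c v1 v2 v3 v4 u1 u2 u3 u4) {d : Sym2 V → β} {U : Set (Sym2 V)}
    (hU : Full G v1 v2 v3 v4 U) : 4 ≤ (res G L U d s(v1, u1)).card := by
  obtain ⟨q, r, h⟩ := X.nbu
  have := X.pb hU h (X.K3 U d q) (X.K3 U d r)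
  omega

lemma Ctx.ku (X : Ctx G L c v1 v2 v3 v4 u1 u2 u3 u4) {d : Sym2 V → β} {U : Set (Sym2 V)}
    (hU : Full G v1 v2 v3 v4 U) : (Kc G U d u1).card ≤ 2 := by
  obtain ⟨q, r, h⟩ := X.nbu
  refine Kc_bd [q, r] ?_
  intro z hz hu
  rcases h z hz with rfl | rfl | rfl
  · exact absurd (hU _ hz (by left; simp)) hu
  · simp
  · simp

lemma Ctx.kus (X : Ctx G L c v1 v2 v3 v4 u1 u2 u3 u4) {U : Set (Sym2 V)}
    (hU : Full G v1 v2 v3 v4 U) (d : Sym2 V → β) : (Kc G U d u1).card ≤ 2 ∧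
    (Kc G U d u2).card ≤ 2 ∧ (Kc G U d u3).card ≤ 2 ∧ (Kc G U d u4).card ≤ 2 :=
  ⟨X.ku hU, X.rot.ku hU.rot, X.rot.rot.ku hU.rot.rot, X.rot.rot.rot.ku hU.rot.rot.rot⟩

lemma kvs {U : Set (Sym2 V)}
    (hU : Full G v1 v2 v3 v4 U) (d : Sym2 V → β) : (Kc G U d v1).card ≤ 0 ∧
    (Kc G U d v2).card ≤ 0 ∧ (Kc G U d v3).card ≤ 0 ∧ (Kc G U d v4).card ≤ 0 :=
  ⟨Kv1 hU, Kv1 hU.rot, Kv1 hU.rot.rot, Kv1 hU.rot.rot.rot⟩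

lemma Ctx.pb4s (X : Ctx G L c v1 v2 v3 v4 u1 u2 u3 u4) {U : Set (Sym2 V)}
    (hU : Full G v1 v2 v3 v4 U) (d : Sym2 V → β) : 4 ≤ (res G L U d s(v1, u1)).card ∧
    4 ≤ (res G L U d s(v2, u2)).card ∧ 4 ≤ (res G L U d s(v3, u3)).card ∧
    4 ≤ (res G L U d s(v4, u4)).card :=
  ⟨X.pb4 hU, X.rot.pb4 hU.rot, X.rot.rot.pb4 hU.rot.rot, X.rot.rot.rot.pb4 hU.rot.rot.rot⟩

/-- chord-free -/
structure NoCh (v1 v2 v3 v4 u1 u2 u3 u4 : V) : Prop where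
  c13 : u1 ≠ v3
  c31 : u3 ≠ v1
  c24 : u2 ≠ v4
  c42 : u4 ≠ v2

lemma Ctx.nc13 (X : Ctx G L c v1 v2 v3 v4 u1 u2 u3 u4) (N : NoCh v1 v2 v3 v4 u1 u2 u3 u4)
    (h1 : u1 ≠ u3) (h2 : ¬ G.Adj u1 u3) : NC G s(v1, u1) s(v3, u3) := by
  apply NC_mk
  intro g1 g2
  have b1 := X.C.b1
  have b3 := X.C.b3
  obtain ⟨q1, q2, q3, q4⟩ := N
  have := X.C.q12
  have := X.C.q14
  have := X.C.q32
  have := X.C.q34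
  have := X.C.n13
  have := X.C.a12.ne
  have := X.C.a23.ne
  have := X.C.a34.ne
  have := X.C.a41.ne
  refine ⟨?_, ?_, ?_, h1, ?_, ?_, ?_, h2⟩
  · grind
  · grind
  · grind
  · intro h; have := b1 _ h; grind
  · intro h; have := b1 _ h; grind
  · intro h; have := b3 _ h.symm; grind

lemma case1 (X : Ctx G L c v1 v2 v3 v4 u1 u2 u3 u4) (N : NoCh v1 v2 v3 v4 u1 u2 u3 u4)
    (h1 : u1 ≠ u3) (h2 : ¬ G.Adj u1 u3) (h3 : u2 ≠ u4) (h4 : ¬ G.Adj u2 u4) :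
    StronglyListColorable G L := by
  have := X.nonempty
  have nc1 := X.nc13 N h1 h2
  have nc2 := X.rot.nc13 ⟨N.c24, N.c42, N.c31, N.c13⟩ h3 h4
  obtain ⟨N1, N2, N3, N4⟩ := N
  have hF := X.full [s(v1, u1), s(v3, u3), s(v2, u2), s(v4, u4), s(v1, v2), s(v2, v3), s(v3, v4), s(v4, v1)]
    (by simp [l8, Sym2.eq_swap])
  refine ext2 _ _ _ _ _ _ rfl [4, 4, 4, 4, 6, 6, 6, 6] 4 rfl ?_ (X.pcU hF) ?_ ?_ ?_ (by decide +kernel)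
  · obtain ⟨e1, e2, e3, e4⟩ := X.C.ne
    have C := X.C
    cases C
    clear hF
    simp only [List.nodup_cons, List.mem_cons, List.not_mem_nil, Sym2.eq_iff]
    repeat' apply And.intro
    all_goals grind (splits := 20) [SimpleGraph.Adj.ne]
  · obtain ⟨k1, k2, k3, k4⟩ := X.kus hF c
    obtain ⟨m1, m2, m3, m4⟩ := kvs hF c
    obtain ⟨p1, p2, p3, p4⟩ := X.pb4s hF c
    obtain ⟨c1, c2, c3, c4⟩ := X.cbs hF k1 k2 k3 k4
    repeat' (first | exact List.Forall₂.nil | refine List.Forall₂.cons ?_ ?_)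
    all_goals omega
  · exact nc1
  · exact nc2

lemma case2a1 (X : Ctx G L c v1 v2 v3 v4 u1 u2 u3 u4) (N : NoCh v1 v2 v3 v4 u1 u2 u3 u4) (h1 : u1 = u3) (h3 : u2 ≠ u4)
    (h4 : ¬ G.Adj u2 u4) :
    StronglyListColorable G L := by
  have := X.nonempty
  have nc2 := X.rot.nc13 ⟨N.c24, N.c42, N.c31, N.c13⟩ h3 h4
  obtain ⟨N1, N2, N3, N4⟩ := N
  subst h1
  have g1 : G.Adj v1 u1 := by
    obtain ⟨e1, e2, e3, e4⟩ := X.C.ne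
    have C := X.C
    cases C
    grind [nb, SimpleGraph.adj_comm]
  have g3 : G.Adj v3 u1 := by
    obtain ⟨e1, e2, e3, e4⟩ := X.C.ne
    have C := X.C
    cases C
    grind [nb, SimpleGraph.adj_comm]
  obtain ⟨r, nr, -, -, -⟩ := X.D2 u1 v1 v3 g1.symm g3.symm X.C.n13
  have hF := X.full [s(v2, u2), s(v4, u4), s(v1, v2), s(v2, v3), s(v3, v4), s(v4, v1), s(v1, u1), s(v3, u1)]
    (by simp [l8, Sym2.eq_swap])
  refine ext1 _ _ _ _ rfl [4, 4, 7, 7, 7, 7, 7, 7] 6 rfl ?_ (X.pcU hF) ?_ ?_ (by decide +kernel)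
  · obtain ⟨e1, e2, e3, e4⟩ := X.C.ne
    have C := X.C
    cases C
    clear hF
    simp only [List.nodup_cons, List.mem_cons, List.not_mem_nil, Sym2.eq_iff]
    repeat' apply And.intro
    all_goals grind (splits := 20) [SimpleGraph.Adj.ne]
  · obtain ⟨k1, k2, k3, k4⟩ := X.kus hF c
    obtain ⟨m1, m2, m3, m4⟩ := kvs hF c
    obtain ⟨p1, p2, p3, p4⟩ := X.pb4s hF c
    have k1 := K1 (c := c) nr (hF _ g1.symm (by simp [Tch])) (hF _ g3.symm (by simp [Tch]))
    have k3 := k1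
    obtain ⟨c1, c2, c3, c4⟩ := X.cbs hF k1 k2 k3 k4
    have w1 := X.pb hF nr m3 (X.K3 _ _ r)
    have w3 := X.rot.rot.pb hF.rot.rot nr.sw m1 (X.K3 _ _ r)
    repeat' (first | exact List.Forall₂.nil | refine List.Forall₂.cons ?_ ?_)
    all_goals omega
  · exact nc2

lemma case2a2 (X : Ctx G L c v1 v2 v3 v4 u1 u2 u3 u4) (N : NoCh v1 v2 v3 v4 u1 u2 u3 u4) (h1 : u1 = u3) (h3 : u2 = u4) :
    StronglyListColorable G L := by
  have := X.nonempty
  obtain ⟨N1, N2, N3, N4⟩ := N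
  subst h1 h3
  have g1 : G.Adj v1 u1 := by
    obtain ⟨e1, e2, e3, e4⟩ := X.C.ne
    have C := X.C
    cases C
    grind [nb, SimpleGraph.adj_comm]
  have g3 : G.Adj v3 u1 := by
    obtain ⟨e1, e2, e3, e4⟩ := X.C.ne
    have C := X.C
    cases C
    grind [nb, SimpleGraph.adj_comm]
  have g2 : G.Adj v2 u2 := by
    obtain ⟨e1, e2, e3, e4⟩ := X.C.ne
    have C := X.C
    cases C
    grind [nb, SimpleGraph.adj_comm]
  have g4 : G.Adj v4 u2 := by
    obtain ⟨e1, e2, e3, e4⟩ := X.C.ne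
    have C := X.C
    cases C
    grind [nb, SimpleGraph.adj_comm]
  obtain ⟨r, nr, -, -, -⟩ := X.D2 u1 v1 v3 g1.symm g3.symm X.C.n13
  obtain ⟨t, nt, -, -, -⟩ := X.D2 u2 v2 v4 g2.symm g4.symm X.C.n24
  have hF := X.full [s(v1, v2), s(v2, v3), s(v3, v4), s(v4, v1), s(v1, u1), s(v2, u2), s(v3, u1), s(v4, u2)]
    (by simp [l8, Sym2.eq_swap])
  refine ext0 _ [8, 8, 8, 8, 7, 7, 7, 7] 8 rfl ?_ (X.pcU hF) ?_ (by decide +kernel)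
  · obtain ⟨e1, e2, e3, e4⟩ := X.C.ne
    have C := X.C
    cases C
    clear hF
    simp only [List.nodup_cons, List.mem_cons, List.not_mem_nil, Sym2.eq_iff]
    repeat' apply And.intro
    all_goals grind (splits := 20) [SimpleGraph.Adj.ne]
  · obtain ⟨k1, k2, k3, k4⟩ := X.kus hF c
    obtain ⟨m1, m2, m3, m4⟩ := kvs hF c
    obtain ⟨p1, p2, p3, p4⟩ := X.pb4s hF c
    have k1 := K1 (c := c) nr (hF _ g1.symm (by simp [Tch])) (hF _ g3.symm (by simp [Tch]))
    have k2 := K1 (c := c) nt (hF _ g2.symm (by simp [Tch])) (hF _ g4.symm (by simp [Tch]))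
    have k3 := k1
    have k4 := k2
    obtain ⟨c1, c2, c3, c4⟩ := X.cbs hF k1 k2 k3 k4
    have w1 := X.pb hF nr m3 (X.K3 _ _ r)
    have w3 := X.rot.rot.pb hF.rot.rot nr.sw m1 (X.K3 _ _ r)
    have w2 := X.rot.pb hF.rot nt m4 (X.K3 _ _ t)
    have w4 := X.rot.rot.rot.pb hF.rot.rot.rot nt.sw m2 (X.K3 _ _ t)
    repeat' (first | exact List.Forall₂.nil | refine List.Forall₂.cons ?_ ?_)
    all_goals omega

lemma case2a3 (X : Ctx G L c v1 v2 v3 v4 u1 u2 u3 u4) (N : NoCh v1 v2 v3 v4 u1 u2 u3 u4) (h1 : u1 = u3) (h4 : G.Adj u2 u4)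
    (h5 : ¬ G.Adj u1 u2) (h6 : ¬ G.Adj u1 u4) :
    StronglyListColorable G L := by
  have := X.nonempty
  obtain ⟨N1, N2, N3, N4⟩ := N
  subst h1
  have g1 : G.Adj v1 u1 := by
    obtain ⟨e1, e2, e3, e4⟩ := X.C.ne
    have C := X.C
    cases C
    grind [nb, SimpleGraph.adj_comm]
  have g3 : G.Adj v3 u1 := by
    obtain ⟨e1, e2, e3, e4⟩ := X.C.ne
    have C := X.C
    cases C
    grind [nb, SimpleGraph.adj_comm]
  have g2 : G.Adj v2 u2 := by
    obtain ⟨e1, e2, e3, e4⟩ := X.C.ne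
    have C := X.C
    cases C
    grind [nb, SimpleGraph.adj_comm]
  have g4 : G.Adj v4 u4 := by
    obtain ⟨e1, e2, e3, e4⟩ := X.C.ne
    have C := X.C
    cases C
    grind [nb, SimpleGraph.adj_comm]
  have f1 : v2 ≠ u4 := fun h => N4 h.symm
  have f2 : v4 ≠ u2 := fun h => N3 h.symm
  obtain ⟨r, nr, -, -, -⟩ := X.D2 u1 v1 v3 g1.symm g3.symm X.C.n13
  obtain ⟨s, ns, -, -, -⟩ := X.D2 u2 v2 u4 g2.symm h4 f1
  obtain ⟨t, nt, -, -, -⟩ := X.D2 u4 v4 u2 g4.symm h4.symm f2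
  have hF := X.full [s(u2, u4), s(v1, u1), s(v1, v2), s(v2, v3), s(v3, v4), s(v4, v1), s(v3, u1), s(v2, u2), s(v4, u4)]
    (by simp [l8, Sym2.eq_swap])
  refine ext1 _ _ _ _ rfl [4, 7, 8, 8, 8, 8, 7, 6, 6] 7 rfl ?_ (X.pcU hF) ?_ ?_ (by decide +kernel)
  · obtain ⟨e1, e2, e3, e4⟩ := X.C.ne
    have C := X.C
    cases C
    clear hF
    simp only [List.nodup_cons, List.mem_cons, List.not_mem_nil, Sym2.eq_iff]
    repeat' apply And.intro
    all_goals grind (splits := 20) [SimpleGraph.Adj.ne]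
  · obtain ⟨k1, k2, k3, k4⟩ := X.kus hF c
    obtain ⟨m1, m2, m3, m4⟩ := kvs hF c
    obtain ⟨p1, p2, p3, p4⟩ := X.pb4s hF c
    have k1 := K1 (c := c) nr (hF _ g1.symm (by simp [Tch])) (hF _ g3.symm (by simp [Tch]))
    have k3 := k1
    have k2 := K1 (c := c) ns (hF _ g2.symm (by simp [Tch])) (by simp [Sym2.eq_swap])
    have k4 := K1 (c := c) nt (hF _ g4.symm (by simp [Tch])) (by simp [Sym2.eq_swap])
    obtain ⟨c1, c2, c3, c4⟩ := X.cbs hF k1 k2 k3 k4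
    have w1 := X.pb hF nr m3 (X.K3 _ _ r)
    have w3 := X.rot.rot.pb hF.rot.rot nr.sw m1 (X.K3 _ _ r)
    have w2 := X.rot.pb hF.rot ns k4 (X.K3 _ _ s)
    have w4 := X.rot.rot.rot.pb hF.rot.rot.rot nt k2 (X.K3 _ _ t)
    have w5 := res_bd (c := c) X.hL ns.sw nt.sw (U := _) (fun _ => (by simp [Sym2.eq_swap])) m2 (X.K3 _ _ s) m4 (X.K3 _ _ t)
    repeat' (first | exact List.Forall₂.nil | refine List.Forall₂.cons ?_ ?_)
    all_goals omega
  · clear hF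
    apply NC_mk
    intro g1 g2
    obtain ⟨e1, e2, e3, e4⟩ := X.C.ne
    have C := X.C
    cases C
    refine ⟨?_, ?_, ?_, ?_, ?_, ?_, ?_, ?_⟩ <;> grind [nb, SimpleGraph.adj_comm]

lemma case2a4 (X : Ctx G L c v1 v2 v3 v4 u1 u2 u3 u4) (N : NoCh v1 v2 v3 v4 u1 u2 u3 u4) (h1 : u1 = u3) (h4 : G.Adj u2 u4)
    (h5 : G.Adj u1 u2) :
    StronglyListColorable G L := by
  have := X.nonempty
  obtain ⟨N1, N2, N3, N4⟩ := N
  subst h1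
  have g1 : G.Adj v1 u1 := by
    obtain ⟨e1, e2, e3, e4⟩ := X.C.ne
    have C := X.C
    cases C
    grind [nb, SimpleGraph.adj_comm]
  have g3 : G.Adj v3 u1 := by
    obtain ⟨e1, e2, e3, e4⟩ := X.C.ne
    have C := X.C
    cases C
    grind [nb, SimpleGraph.adj_comm]
  have g2 : G.Adj v2 u2 := by
    obtain ⟨e1, e2, e3, e4⟩ := X.C.ne
    have C := X.C
    cases C
    grind [nb, SimpleGraph.adj_comm]
  have g4 : G.Adj v4 u4 := by
    obtain ⟨e1, e2, e3, e4⟩ := X.C.ne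
    have C := X.C
    cases C
    grind [nb, SimpleGraph.adj_comm]
  have f1 : v2 ≠ u4 := fun h => N4 h.symm
  have f2 : v4 ≠ u2 := fun h => N3 h.symm
  have nr := X.D3 u1 v1 v3 u2 g1.symm g3.symm h5 X.C.n13 X.C.q21.symm X.C.q23.symm
  obtain ⟨t, nt, -, -, -⟩ := X.D2 u4 v4 u2 g4.symm h4.symm f2
  have f3 : u4 ≠ u1 := by
    intro h
    have := nr v4 (h ▸ g4.symm)
    obtain ⟨e1, e2, e3, e4⟩ := X.C.ne
    grind
  have ns := X.D3 u2 v2 u4 u1 g2.symm h4 h5.symm f1 X.C.q12.symm f3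
  have hF := X.full [s(v1, v2), s(v2, v3), s(v3, v4), s(v4, v1), s(v1, u1), s(v3, u1), s(v2, u2), s(v4, u4), s(u2, u4)]
    (by simp [l8, Sym2.eq_swap])
  refine ext0 _ [8, 8, 8, 8, 9, 9, 8, 6, 6] 9 rfl ?_ (X.pcU hF) ?_ (by decide +kernel)
  · obtain ⟨e1, e2, e3, e4⟩ := X.C.ne
    have C := X.C
    cases C
    clear hF
    simp only [List.nodup_cons, List.mem_cons, List.not_mem_nil, Sym2.eq_iff]
    repeat' apply And.intro
    all_goals grind (splits := 20) [SimpleGraph.Adj.ne]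
  · obtain ⟨k1, k2, k3, k4⟩ := X.kus hF c
    obtain ⟨m1, m2, m3, m4⟩ := kvs hF c
    obtain ⟨p1, p2, p3, p4⟩ := X.pb4s hF c
    have k1 := K1 (c := c) nr (hF _ g1.symm (by simp [Tch])) (hF _ g3.symm (by simp [Tch]))
    have k3 := k1
    have k2 := K1 (c := c) ns (hF _ g2.symm (by simp [Tch])) (by simp [Sym2.eq_swap])
    have k4 := K1 (c := c) nt (hF _ g4.symm (by simp [Tch])) (by simp [Sym2.eq_swap])
    obtain ⟨c1, c2, c3, c4⟩ := X.cbs hF k1 k2 k3 k4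
    have w1 := X.pb hF nr m3 k2
    have w3 := X.rot.rot.pb hF.rot.rot nr.sw m1 k2
    have w2 := X.rot.pb hF.rot ns k4 k1
    have w4 := X.rot.rot.rot.pb hF.rot.rot.rot nt k2 (X.K3 _ _ t)
    have w5 := res_bd (c := c) X.hL ns.sw nt.sw (fun _ => (by simp [Sym2.eq_swap])) m2 k1 m4 (X.K3 _ _ t)
    repeat' (first | exact List.Forall₂.nil | refine List.Forall₂.cons ?_ ?_)
    all_goals omega

lemma case3i (X : Ctx G L c v1 v2 v3 v4 u1 u2 u3 u4) (N : NoCh v1 v2 v3 v4 u1 u2 u3 u4) (h1 : G.Adj u1 u3) (h2 : u2 = u1) :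
    StronglyListColorable G L := by
  have := X.nonempty
  obtain ⟨N1, N2, N3, N4⟩ := N
  subst h2
  have g1 : G.Adj v1 u2 := by
    obtain ⟨e1, e2, e3, e4⟩ := X.C.ne
    have C := X.C
    cases C
    grind [nb, SimpleGraph.adj_comm]
  have g3 : G.Adj v3 u3 := by
    obtain ⟨e1, e2, e3, e4⟩ := X.C.ne
    have C := X.C
    cases C
    grind [nb, SimpleGraph.adj_comm]
  have g2 : G.Adj v2 u2 := by
    obtain ⟨e1, e2, e3, e4⟩ := X.C.ne
    have C := X.C
    cases C
    grind [nb, SimpleGraph.adj_comm]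
  have nx := X.D3 u2 v1 v2 u3 g1.symm g2.symm h1 X.C.ne.1 N2.symm X.C.q32.symm
  obtain ⟨y, ny, -, -, -⟩ := X.D2 u3 v3 u2 g3.symm h1.symm N1.symm
  have hF := X.full [s(v1, v2), s(v2, v3), s(v3, v4), s(v4, v1), s(v1, u2), s(v2, u2), s(v3, u3), s(v4, u4), s(u2, u3)]
    (by simp [l8, Sym2.eq_swap])
  refine ext0 _ [10, 9, 7, 8, 9, 9, 7, 4, 7] 9 rfl ?_ (X.pcU hF) ?_ (by decide +kernel)
  · obtain ⟨e1, e2, e3, e4⟩ := X.C.ne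
    have C := X.C
    cases C
    clear hF
    simp only [List.nodup_cons, List.mem_cons, List.not_mem_nil, Sym2.eq_iff]
    repeat' apply And.intro
    all_goals grind (splits := 20) [SimpleGraph.Adj.ne]
  · obtain ⟨k1, k2, k3, k4⟩ := X.kus hF c
    obtain ⟨m1, m2, m3, m4⟩ := kvs hF c
    obtain ⟨p1, p2, p3, p4⟩ := X.pb4s hF c
    have k1 := K0 (c := c) nx (hF _ g1.symm (by simp [Tch])) (hF _ g2.symm (by simp [Tch])) (fun _ => (by simp [Sym2.eq_swap]))
    have k2 := k1
    have k3 := K1 (c := c) ny (hF _ g3.symm (by simp [Tch])) (by simp [Sym2.eq_swap])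
    obtain ⟨c1, c2, c3, c4⟩ := X.cbs hF k1 k2 k3 k4
    have w1 := X.pb hF nx m2 k3
    have w2 := X.rot.pb hF.rot nx.sw m1 k3
    have w3 := X.rot.rot.pb hF.rot.rot ny k1 (X.K3 _ _ y)
    have w5 := res_bd (c := c) X.hL nx.rt ny.sw (fun _ => (by simp [Sym2.eq_swap])) m1 m2 m3 (X.K3 _ _ y)
    repeat' (first | exact List.Forall₂.nil | refine List.Forall₂.cons ?_ ?_)
    all_goals omega

lemma case3iia (X : Ctx G L c v1 v2 v3 v4 u1 u2 u3 u4) (N : NoCh v1 v2 v3 v4 u1 u2 u3 u4) (h1 : G.Adj u1 u3) (h2 : G.Adj u1 u2)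
    (d1 : u1 ≠ u2) (d2 : u1 ≠ u4) (d3 : u3 ≠ u2) (d4 : u3 ≠ u4) (d5 : u2 ≠ u4)
    (h3 : ¬ G.Adj u3 u4) :
    StronglyListColorable G L := by
  have := X.nonempty
  obtain ⟨N1, N2, N3, N4⟩ := N
  have g1 : G.Adj v1 u1 := by
    obtain ⟨e1, e2, e3, e4⟩ := X.C.ne
    have C := X.C
    cases C
    grind [nb, SimpleGraph.adj_comm]
  have g3 : G.Adj v3 u3 := by
    obtain ⟨e1, e2, e3, e4⟩ := X.C.ne
    have C := X.C
    cases C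
    grind [nb, SimpleGraph.adj_comm]
  have g2 : G.Adj v2 u2 := by
    obtain ⟨e1, e2, e3, e4⟩ := X.C.ne
    have C := X.C
    cases C
    grind [nb, SimpleGraph.adj_comm]
  have nx := X.D3 u1 v1 u3 u2 g1.symm h1 h2 N2.symm X.C.q21.symm d3
  obtain ⟨z, nz, -, -, -⟩ := X.D2 u2 v2 u1 g2.symm h2.symm X.C.q12.symm
  obtain ⟨y, ny, -, -, -⟩ := X.D2 u3 v3 u1 g3.symm h1.symm N1.symm
  have hF := X.full [s(v4, u4), s(u1, u3), s(v3, v4), s(u1, u2), s(v1, v2), s(v4, v1), s(v2, v3), s(v1, u1), s(v3, u3), s(v2, u2)]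
    (by simp [l8, Sym2.eq_swap])
  refine ext2 _ _ _ _ _ _ rfl [4, 6, 7, 6, 9, 8, 8, 8, 7, 7] 6 rfl ?_ (X.pcU hF) ?_ ?_ ?_ (by decide +kernel)
  · obtain ⟨e1, e2, e3, e4⟩ := X.C.ne
    have C := X.C
    cases C
    clear hF
    simp only [List.nodup_cons, List.mem_cons, List.not_mem_nil, Sym2.eq_iff]
    repeat' apply And.intro
    all_goals grind (splits := 20) [SimpleGraph.Adj.ne]
  · obtain ⟨k1, k2, k3, k4⟩ := X.kus hF c
    obtain ⟨m1, m2, m3, m4⟩ := kvs hF c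
    obtain ⟨p1, p2, p3, p4⟩ := X.pb4s hF c
    have k1 := K0 (c := c) nx (hF _ g1.symm (by simp [Tch])) (by simp [Sym2.eq_swap]) (fun _ => (by simp [Sym2.eq_swap]))
    have k2 := K1 (c := c) nz (hF _ g2.symm (by simp [Tch])) (by simp [Sym2.eq_swap])
    have k3 := K1 (c := c) ny (hF _ g3.symm (by simp [Tch])) (by simp [Sym2.eq_swap])
    obtain ⟨c1, c2, c3, c4⟩ := X.cbs hF k1 k2 k3 k4
    have w1 := X.pb hF nx k3 k2
    have w3 := X.rot.rot.pb hF.rot.rot ny k1 (X.K3 _ _ y)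
    have w2 := X.rot.pb hF.rot nz k1 (X.K3 _ _ z)
    have w5 := res_bd (c := c) X.hL nx.sw ny.sw (fun _ => (by simp [Sym2.eq_swap])) m1 k2 m3 (X.K3 _ _ y)
    have w6 := res_bd (c := c) X.hL nx.rt nz.sw (fun _ => (by simp [Sym2.eq_swap])) m1 k3 m2 (X.K3 _ _ z)
    repeat' (first | exact List.Forall₂.nil | refine List.Forall₂.cons ?_ ?_)
    all_goals omega
  · clear hF
    apply NC_mk
    intro g1 g2
    obtain ⟨e1, e2, e3, e4⟩ := X.C.ne
    have C := X.C
    cases C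
    refine ⟨?_, ?_, ?_, ?_, ?_, ?_, ?_, ?_⟩ <;> grind [nb, SimpleGraph.adj_comm]
  · clear hF
    apply NC_mk
    intro g1 g2
    obtain ⟨e1, e2, e3, e4⟩ := X.C.ne
    have C := X.C
    cases C
    refine ⟨?_, ?_, ?_, ?_, ?_, ?_, ?_, ?_⟩ <;> grind [nb, SimpleGraph.adj_comm]

lemma case3iib (X : Ctx G L c v1 v2 v3 v4 u1 u2 u3 u4) (N : NoCh v1 v2 v3 v4 u1 u2 u3 u4) (h1 : G.Adj u1 u3) (h2 : G.Adj u1 u2)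
    (d1 : u1 ≠ u2) (d2 : u1 ≠ u4) (d3 : u3 ≠ u2) (d4 : u3 ≠ u4) (d5 : u2 ≠ u4)
    (h3 : G.Adj u3 u4) :
    StronglyListColorable G L := by
  have := X.nonempty
  obtain ⟨N1, N2, N3, N4⟩ := N
  have g1 : G.Adj v1 u1 := by
    obtain ⟨e1, e2, e3, e4⟩ := X.C.ne
    have C := X.C
    cases C
    grind [nb, SimpleGraph.adj_comm]
  have g3 : G.Adj v3 u3 := by
    obtain ⟨e1, e2, e3, e4⟩ := X.C.ne
    have C := X.C
    cases C
    grind [nb, SimpleGraph.adj_comm]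
  have g2 : G.Adj v2 u2 := by
    obtain ⟨e1, e2, e3, e4⟩ := X.C.ne
    have C := X.C
    cases C
    grind [nb, SimpleGraph.adj_comm]
  have nx := X.D3 u1 v1 u3 u2 g1.symm h1 h2 N2.symm X.C.q21.symm d3
  obtain ⟨z, nz, -, -, -⟩ := X.D2 u2 v2 u1 g2.symm h2.symm X.C.q12.symm
  have g4 : G.Adj v4 u4 := by
    obtain ⟨e1, e2, e3, e4⟩ := X.C.ne
    have C := X.C
    cases C
    grind [nb, SimpleGraph.adj_comm]
  have ny := X.D3 u3 v3 u1 u4 g3.symm h1.symm h3 N1.symm X.C.q43.symm d2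
  obtain ⟨w, nw, -, -, -⟩ := X.D2 u4 v4 u3 g4.symm h3.symm X.C.q34.symm
  have hF := X.full [s(u3, u4), s(v1, v2), s(u1, u2), s(v3, v4), s(v2, u2), s(v4, u4), s(u1, u3), s(v4, v1), s(v2, v3), s(v1, u1), s(v3, u3)]
    (by simp [l8, Sym2.eq_swap])
  refine ext2 _ _ _ _ _ _ rfl [7, 9, 7, 9, 7, 7, 8, 9, 9, 9, 9] 7 rfl ?_ (X.pcU hF) ?_ ?_ ?_ (by decide +kernel)
  · obtain ⟨e1, e2, e3, e4⟩ := X.C.ne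
    have C := X.C
    cases C
    clear hF
    simp only [List.nodup_cons, List.mem_cons, List.not_mem_nil, Sym2.eq_iff]
    repeat' apply And.intro
    all_goals grind (splits := 20) [SimpleGraph.Adj.ne]
  · obtain ⟨k1, k2, k3, k4⟩ := X.kus hF c
    obtain ⟨m1, m2, m3, m4⟩ := kvs hF c
    obtain ⟨p1, p2, p3, p4⟩ := X.pb4s hF c
    have k1 := K0 (c := c) nx (hF _ g1.symm (by simp [Tch])) (by simp [Sym2.eq_swap]) (fun _ => (by simp [Sym2.eq_swap]))
    have k2 := K1 (c := c) nz (hF _ g2.symm (by simp [Tch])) (by simp [Sym2.eq_swap])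
    have k3 := K0 (c := c) ny (hF _ g3.symm (by simp [Tch])) (by simp [Sym2.eq_swap]) (fun _ => (by simp [Sym2.eq_swap]))
    have k4 := K1 (c := c) nw (hF _ g4.symm (by simp [Tch])) (by simp [Sym2.eq_swap])
    obtain ⟨c1, c2, c3, c4⟩ := X.cbs hF k1 k2 k3 k4
    have w1 := X.pb hF nx k3 k2
    have w3 := X.rot.rot.pb hF.rot.rot ny k1 k4
    have w2 := X.rot.pb hF.rot nz k1 (X.K3 _ _ z)
    have w4 := X.rot.rot.rot.pb hF.rot.rot.rot nw k3 (X.K3 _ _ w)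
    have w5 := res_bd (c := c) X.hL nx.sw ny.sw (fun _ => (by simp [Sym2.eq_swap])) m1 k2 m3 k4
    have w6 := res_bd (c := c) X.hL nx.rt nz.sw (fun _ => (by simp [Sym2.eq_swap])) m1 k3 m2 (X.K3 _ _ z)
    have w7 := res_bd (c := c) X.hL ny.rt nw.sw (fun _ => (by simp [Sym2.eq_swap])) m3 k1 m4 (X.K3 _ _ w)
    repeat' (first | exact List.Forall₂.nil | refine List.Forall₂.cons ?_ ?_)
    all_goals omega
  · clear hF
    apply NC_mk
    intro g1 g2
    obtain ⟨e1, e2, e3, e4⟩ := X.C.ne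
    have C := X.C
    cases C
    refine ⟨?_, ?_, ?_, ?_, ?_, ?_, ?_, ?_⟩ <;> grind [nb, SimpleGraph.adj_comm]
  · clear hF
    apply NC_mk
    intro g1 g2
    obtain ⟨e1, e2, e3, e4⟩ := X.C.ne
    have C := X.C
    cases C
    refine ⟨?_, ?_, ?_, ?_, ?_, ?_, ?_, ?_⟩ <;> grind [nb, SimpleGraph.adj_comm]

lemma case3iii (X : Ctx G L c v1 v2 v3 v4 u1 u2 u3 u4) (N : NoCh v1 v2 v3 v4 u1 u2 u3 u4) (h1 : G.Adj u1 u3) (h4 : G.Adj u2 u4)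
    (d1 : u1 ≠ u2) (d2 : u1 ≠ u4) (d3 : u3 ≠ u2) (d4 : u3 ≠ u4) (d5 : u2 ≠ u4)
    (j1 : ¬ G.Adj u1 u2) (j2 : ¬ G.Adj u1 u4) (j3 : ¬ G.Adj u3 u2) (j4 : ¬ G.Adj u3 u4) :
    StronglyListColorable G L := by
  have := X.nonempty
  obtain ⟨N1, N2, N3, N4⟩ := N
  have g1 : G.Adj v1 u1 := by
    obtain ⟨e1, e2, e3, e4⟩ := X.C.ne
    have C := X.C
    cases C
    grind [nb, SimpleGraph.adj_comm]
  have g3 : G.Adj v3 u3 := by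
    obtain ⟨e1, e2, e3, e4⟩ := X.C.ne
    have C := X.C
    cases C
    grind [nb, SimpleGraph.adj_comm]
  have g2 : G.Adj v2 u2 := by
    obtain ⟨e1, e2, e3, e4⟩ := X.C.ne
    have C := X.C
    cases C
    grind [nb, SimpleGraph.adj_comm]
  have g4 : G.Adj v4 u4 := by
    obtain ⟨e1, e2, e3, e4⟩ := X.C.ne
    have C := X.C
    cases C
    grind [nb, SimpleGraph.adj_comm]
  obtain ⟨x, nx, -, -, -⟩ := X.D2 u1 v1 u3 g1.symm h1 N2.symm
  obtain ⟨y, ny, -, -, -⟩ := X.D2 u3 v3 u1 g3.symm h1.symm N1.symm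
  obtain ⟨s, ns, -, -, -⟩ := X.D2 u2 v2 u4 g2.symm h4 N4.symm
  obtain ⟨t, nt, -, -, -⟩ := X.D2 u4 v4 u2 g4.symm h4.symm N3.symm
  have hF := X.full [s(u1, u3), s(v2, u2), s(u2, u4), s(v1, u1), s(v1, v2), s(v2, v3), s(v3, v4), s(v4, v1), s(v3, u3), s(v4, u4)]
    (by simp [l8, Sym2.eq_swap])
  refine ext2 _ _ _ _ _ _ rfl [4, 6, 4, 6, 8, 8, 8, 8, 6, 6] 6 rfl ?_ (X.pcU hF) ?_ ?_ ?_ (by decide +kernel)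
  · obtain ⟨e1, e2, e3, e4⟩ := X.C.ne
    have C := X.C
    cases C
    clear hF
    simp only [List.nodup_cons, List.mem_cons, List.not_mem_nil, Sym2.eq_iff]
    repeat' apply And.intro
    all_goals grind (splits := 20) [SimpleGraph.Adj.ne]
  · obtain ⟨k1, k2, k3, k4⟩ := X.kus hF c
    obtain ⟨m1, m2, m3, m4⟩ := kvs hF c
    obtain ⟨p1, p2, p3, p4⟩ := X.pb4s hF c
    have k1 := K1 (c := c) nx (hF _ g1.symm (by simp [Tch])) (by simp [Sym2.eq_swap])
    have k3 := K1 (c := c) ny (hF _ g3.symm (by simp [Tch])) (by simp [Sym2.eq_swap])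
    have k2 := K1 (c := c) ns (hF _ g2.symm (by simp [Tch])) (by simp [Sym2.eq_swap])
    have k4 := K1 (c := c) nt (hF _ g4.symm (by simp [Tch])) (by simp [Sym2.eq_swap])
    obtain ⟨c1, c2, c3, c4⟩ := X.cbs hF k1 k2 k3 k4
    have w1 := X.pb hF nx k3 (X.K3 _ _ x)
    have w3 := X.rot.rot.pb hF.rot.rot ny k1 (X.K3 _ _ y)
    have w2 := X.rot.pb hF.rot ns k4 (X.K3 _ _ s)
    have w4 := X.rot.rot.rot.pb hF.rot.rot.rot nt k2 (X.K3 _ _ t)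
    have w5 := res_bd (c := c) X.hL ns.sw nt.sw (fun _ => (by simp [Sym2.eq_swap])) m2 (X.K3 _ _ s) m4 (X.K3 _ _ t)
    have w6 := res_bd (c := c) X.hL nx.sw ny.sw (fun _ => (by simp [Sym2.eq_swap])) m1 (X.K3 _ _ x) m3 (X.K3 _ _ y)
    repeat' (first | exact List.Forall₂.nil | refine List.Forall₂.cons ?_ ?_)
    all_goals omega
  · clear hF
    apply NC_mk
    intro g1 g2
    obtain ⟨e1, e2, e3, e4⟩ := X.C.ne
    have C := X.C
    cases C
    refine ⟨?_, ?_, ?_, ?_, ?_, ?_, ?_, ?_⟩ <;> grind [nb, SimpleGraph.adj_comm]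
  · clear hF
    apply NC_mk
    intro g1 g2
    obtain ⟨e1, e2, e3, e4⟩ := X.C.ne
    have C := X.C
    cases C
    refine ⟨?_, ?_, ?_, ?_, ?_, ?_, ?_, ?_⟩ <;> grind [nb, SimpleGraph.adj_comm]

lemma caseCh2 (X : Ctx G L c v1 v2 v3 v4 u1 u2 u3 u4) (h1 : u1 = v3) (h2 : u3 = v1) (h3 : u2 = v4) (h4 : u4 = v2) :
    StronglyListColorable G L := by
  have := X.nonempty
  subst u1 u3 u2 u4
  have hF := X.full [s(v1, v2), s(v2, v3), s(v3, v4), s(v4, v1), s(v1, v3), s(v2, v4)]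
    (by simp [l8, Sym2.eq_swap])
  refine ext0 _ [10, 10, 10, 10, 10, 10] 6 rfl ?_ (X.pcU hF) ?_ (by decide +kernel)
  · obtain ⟨e1, e2, e3, e4⟩ := X.C.ne
    have C := X.C
    cases C
    clear hF
    simp only [List.nodup_cons, List.mem_cons, List.not_mem_nil, Sym2.eq_iff]
    repeat' apply And.intro
    all_goals grind (splits := 20) [SimpleGraph.Adj.ne]
  · obtain ⟨k1, k2, k3, k4⟩ := X.kus hF c
    obtain ⟨m1, m2, m3, m4⟩ := kvs hF c
    obtain ⟨p1, p2, p3, p4⟩ := X.pb4s hF c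
    obtain ⟨c1, c2, c3, c4⟩ := X.cbs hF m3 m4 m1 m2
    have w1 := X.pb hF X.C.b3.rt m2 m4
    have w2 := X.rot.pb hF.rot X.C.b4.rt m1 m3
    repeat' (first | exact List.Forall₂.nil | refine List.Forall₂.cons ?_ ?_)
    all_goals omega

lemma caseCh1 (X : Ctx G L c v1 v2 v3 v4 u1 u2 u3 u4) (h1 : u1 = v3) (h2 : u3 = v1) (N3 : u2 ≠ v4) (N4 : u4 ≠ v2) :
    StronglyListColorable G L := by
  have := X.nonempty
  subst u1 u3
  have hF := X.full [s(v1, v2), s(v2, v3), s(v3, v4), s(v4, v1), s(v1, v3), s(v2, u2), s(v4, u4)]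
    (by simp [l8, Sym2.eq_swap])
  refine ext0 _ [8, 8, 8, 8, 10, 4, 4] 7 rfl ?_ (X.pcU hF) ?_ (by decide +kernel)
  · obtain ⟨e1, e2, e3, e4⟩ := X.C.ne
    have C := X.C
    cases C
    clear hF
    simp only [List.nodup_cons, List.mem_cons, List.not_mem_nil, Sym2.eq_iff]
    repeat' apply And.intro
    all_goals grind (splits := 20) [SimpleGraph.Adj.ne]
  · obtain ⟨k1, k2, k3, k4⟩ := X.kus hF c
    obtain ⟨m1, m2, m3, m4⟩ := kvs hF c
    obtain ⟨p1, p2, p3, p4⟩ := X.pb4s hF c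
    obtain ⟨c1, c2, c3, c4⟩ := X.cbs hF m3 k2 m1 k4
    have w1 := X.pb hF X.C.b3.rt m2 m4
    repeat' (first | exact List.Forall₂.nil | refine List.Forall₂.cons ?_ ?_)
    all_goals omega


end

lemma pick {β : Type*} [DecidableEq β] (R S T : Finset β) (hR : 3 ≤ R.card) (hS : 8 ≤ S.card)
    (hT : 7 ≤ T.card) : ∃ a ∈ R, 8 ≤ (S.erase a ∪ T).card := by
  by_cases h : ∃ a ∈ R, a ∉ S ∨ a ∈ T
  · obtain ⟨a, ha, h⟩ := h
    refine ⟨a, ha, hS.trans (Finset.card_le_card ?_)⟩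
    intro z hz
    by_cases hza : z = a <;> grind
  · push Not at h
    obtain ⟨a, ha⟩ := Finset.card_pos.1 (by omega : 0 < R.card)
    refine ⟨a, ha, ?_⟩
    have h1 : (R.erase a ∪ T).card ≤ (S.erase a ∪ T).card := by
      apply Finset.card_le_card
      intro z hz
      grind
    have h2 : Disjoint (R.erase a) T := by
      rw [Finset.disjoint_left]
      intro z hz
      exact (h z (Finset.mem_of_mem_erase hz)).2
    rw [Finset.card_union_of_disjoint h2, Finset.card_erase_of_mem ha] at h1
    omega

lemma pc_update {V β : Type*} [DecidableEq (Sym2 V)] {G : SimpleGraph V} {L : Sym2 V → Finset β}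
    {c : Sym2 V → β} {X : Sym2 V} {l : List (Sym2 V)} (h : PCol G L {e | e ∈ X :: l} c) {a : β}
    (ha : a ∈ res G L {e | e ∈ X :: l} c X) : PCol G L {e | e ∈ l} (Function.update c X a) := by
  classical
  unfold res at ha
  rw [Finset.mem_filter] at ha
  obtain ⟨ha1, ha2⟩ := ha
  have hm : ∀ e, e ∉ {e | e ∈ l} → e ≠ X → e ∉ {e | e ∈ X :: l} := by
    intro e h1 h2
    simp only [Set.mem_ofPred_eq, List.mem_cons] at *
    tauto
  constructor
  · intro e he f hf heU hfU hef hs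
    by_cases h1 : e = X
    · subst h1
      have h2 : f ≠ e := fun h => hef h.symm
      rw [Function.update_self, Function.update_of_ne h2]
      exact (ha2 f hf (hm f hfU h2) hs).symm
    · by_cases h2 : f = X
      · subst h2
        rw [Function.update_self, Function.update_of_ne h1]
        exact ha2 e he (hm e heU h1) (sees_symm hs)
      · rw [Function.update_of_ne h1, Function.update_of_ne h2]
        exact h.1 e he f hf (hm e heU h1) (hm f hfU h2) hef hs
  · intro e he heU
    by_cases h1 : e = X
    · subst h1
      rw [Function.update_self]
      exact ha1
    · rw [Function.update_of_ne h1]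
      exact h.2 e he (hm e heU h1)

lemma res_update {V β : Type*} [DecidableEq (Sym2 V)] {G : SimpleGraph V} {L : Sym2 V → Finset β}
    {c : Sym2 V → β} {X e : Sym2 V} {l : List (Sym2 V)} {a z : β}
    (hz : z ∈ res G L {e | e ∈ X :: l} c e)
    (h : z ≠ a ∨ ¬ (X ∈ G.edgeSet ∧ StrongSees G e X)) :
    z ∈ res G L {e | e ∈ l} (Function.update c X a) e := by
  classical
  unfold res at hz ⊢
  rw [Finset.mem_filter] at hz ⊢
  refine ⟨hz.1, ?_⟩
  intro f hf hfU hs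
  by_cases h1 : f = X
  · subst h1
    rw [Function.update_self]
    rcases h with h | h
    · exact h.symm
    · exact absurd ⟨hf, hs⟩ h
  · rw [Function.update_of_ne h1]
    refine hz.2 f hf ?_ hs
    simp only [Set.mem_ofPred_eq, List.mem_cons] at *
    tauto

section
variable {V β : Type*} [Fintype V] {G : SimpleGraph V} {L : Sym2 V → Finset β}
    {c : Sym2 V → β} {v1 v2 v3 v4 u1 u2 u3 u4 : V}

lemma case3iv (X : Ctx G L c v1 v2 v3 v4 u1 u2 u3 u4) (N : NoCh v1 v2 v3 v4 u1 u2 u3 u4)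
    (h1 : G.Adj u1 u3) (h4 : ¬ G.Adj u2 u4)
    (d1 : u1 ≠ u2) (d2 : u1 ≠ u4) (d3 : u3 ≠ u2) (d4 : u3 ≠ u4) (d5 : u2 ≠ u4)
    (j1 : ¬ G.Adj u1 u2) (j2 : ¬ G.Adj u1 u4) (j3 : ¬ G.Adj u3 u2) (j4 : ¬ G.Adj u3 u4) :
    StronglyListColorable G L := by
  classical
  have := X.nonempty
  have nc24 := X.rot.nc13 ⟨N.c24, N.c42, N.c31, N.c13⟩ d5 h4
  obtain ⟨N1, N2, N3, N4⟩ := N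
  have g1 : G.Adj v1 u1 := by
    obtain ⟨e1, e2, e3, e4⟩ := X.C.ne
    have C := X.C
    cases C
    grind [nb, SimpleGraph.adj_comm]
  have g3 : G.Adj v3 u3 := by
    obtain ⟨e1, e2, e3, e4⟩ := X.C.ne
    have C := X.C
    cases C
    grind [nb, SimpleGraph.adj_comm]
  obtain ⟨x, nx, ax, x1, x3⟩ := X.D2 u1 v1 u3 g1.symm h1 N2.symm
  obtain ⟨y, ny, -, -, -⟩ := X.D2 u3 v3 u1 g3.symm h1.symm N1.symm
  obtain ⟨q, r, nxx⟩ : ∃ q r, nb G x u1 q r := by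
    rcases ax with h | h
    · exact X.D1 _ _ h.symm
    · subst h; exact ⟨_, _, nx.rt⟩
  have ncX : NC G s(v2, v3) s(u1, x) := by
    apply NC_mk
    intro _ gx
    obtain ⟨e1, e2, e3, e4⟩ := X.C.ne
    have C := X.C
    cases C
    rename_i b1 b2 b3 b4 _ _ _ _ _ _ _ _ _ _ _ _
    clear nc24 nx nxx ny ax X
    have gn := g1.ne
    have gn3 := h1.ne
    have z2 : ¬ G.Adj u1 v2 := fun h => by have := b2 _ h.symm; grind
    have z3 : ¬ G.Adj u1 v3 := fun h => by have := b3 _ h.symm; grind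
    have z4 : ¬ G.Adj u1 v4 := fun h => by have := b4 _ h.symm; grind
    refine ⟨?_, ?_, ?_, ?_, ?_, ?_, ?_, ?_⟩ <;> grind [nb, SimpleGraph.adj_comm]
  have ncP2 : NC G s(v2, u2) s(u1, u3) := by
    apply NC_mk
    intro g5 g6
    obtain ⟨e1, e2, e3, e4⟩ := X.C.ne
    have C := X.C
    cases C
    refine ⟨?_, ?_, ?_, ?_, ?_, ?_, ?_, ?_⟩ <;> grind [nb, SimpleGraph.adj_comm]
  have ncP4 : NC G s(v4, u4) s(u1, u3) := by
    apply NC_mk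
    intro g5 g6
    obtain ⟨e1, e2, e3, e4⟩ := X.C.ne
    have C := X.C
    cases C
    refine ⟨?_, ?_, ?_, ?_, ?_, ?_, ?_, ?_⟩ <;> grind [nb, SimpleGraph.adj_comm]
  set l : List (Sym2 V) := [s(v2, u2), s(v4, u4), s(u1, u3), s(v1, v2), s(v2, v3), s(v3, v4),
    s(v4, v1), s(v1, u1), s(v3, u3)] with hl
  have hF10 := X.full (s(u1, x) :: l) (by simp [l8, hl, Sym2.eq_swap])
  have hF := X.full l (by simp [l8, hl, Sym2.eq_swap])
  have hQ : s(u1, u3) ∈ {e | e ∈ l} := by simp [hl]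
  have hQ' : s(u3, u1) ∈ {e | e ∈ l} := by rw [Sym2.eq_swap]; exact hQ
  have hQ10 : s(u1, u3) ∈ {e | e ∈ s(u1, x) :: l} := by simp [hl]
  have hQ10' : s(u3, u1) ∈ {e | e ∈ s(u1, x) :: l} := by
    rw [Sym2.eq_swap (a := u3)]; exact hQ10
  obtain ⟨a, ha, hcard⟩ : ∃ a ∈ res G L {e | e ∈ s(u1, x) :: l} c s(u1, x),
      8 ≤ ((res G L {e | e ∈ s(u1, x) :: l} c s(v1, v2)).erase a ∪
        res G L {e | e ∈ s(u1, x) :: l} c s(v2, v3)).card := by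
    obtain ⟨k1, k2, k3, k4⟩ := X.kus hF10 c
    obtain ⟨m1, m2, m3, m4⟩ := kvs hF10 c
    have k1 := K0 (c := c) nx (hF10 _ g1.symm (by simp [Tch])) hQ10 (fun _ => by simp)
    have k3 := K1 (c := c) ny (hF10 _ g3.symm (by simp [Tch])) hQ10'
    obtain ⟨c1, c2, c3, c4⟩ := X.cbs hF10 k1 k2 k3 k4
    have w := res_bd (c := c) X.hL nx.rt nxx (fun _ => by simp) m1 k3 (X.K3 _ _ q) (X.K3 _ _ r)
    exact pick _ _ _ (by omega) (by omega) (by omega)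
  have hpc := pc_update (X.pcU hF10) ha
  refine ext3 _ _ _ _ _ _ _ _ _ l hl ?_ hpc ?_ nc24 ncP2 ncP4 ?_
  · obtain ⟨e1, e2, e3, e4⟩ := X.C.ne
    have C := X.C
    cases C
    clear hF hF10 hpc ha hcard hQ hQ' hQ10 hQ10'
    rw [hl]
    clear hl
    simp only [List.nodup_cons, List.mem_cons, List.not_mem_nil, Sym2.eq_iff]
    repeat' apply And.intro
    all_goals grind (splits := 20) [SimpleGraph.Adj.ne]
  · generalize Function.update c s(u1, x) a = d
    obtain ⟨k1, k2, k3, k4⟩ := X.kus hF d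
    obtain ⟨m1, m2, m3, m4⟩ := kvs hF d
    obtain ⟨p1, p2, p3, p4⟩ := X.pb4s hF d
    have k1 := K1 (c := d) nx (hF _ g1.symm (by simp [Tch])) hQ
    have k3 := K1 (c := d) ny (hF _ g3.symm (by simp [Tch])) hQ'
    obtain ⟨c1, c2, c3, c4⟩ := X.cbs hF k1 k2 k3 k4
    have w1 := X.pb hF nx k3 (X.K3 _ _ x)
    have w3 := X.rot.rot.pb hF.rot.rot ny k1 (X.K3 _ _ y)
    have w5 := res_bd (c := d) X.hL nx.sw ny.sw (fun _ => hQ) m1 (X.K3 _ _ x) m3 (X.K3 _ _ y)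
    clear_value l
    generalize {e | e ∈ l} = U at *
    subst hl
    repeat' (first | exact List.Forall₂.nil | refine List.Forall₂.cons ?_ ?_)
    all_goals omega
  · refine hcard.trans (Finset.card_le_card (Finset.union_subset_union ?_ ?_))
    · intro z hz
      rw [Finset.mem_erase] at hz
      exact res_update hz.2 (Or.inl hz.1)
    · intro z hz
      exact res_update hz (Or.inr fun h => ncX ⟨X.C.a23, h.1, h.2⟩)

end

section
variable {V β : Type*} [Fintype V] {G : SimpleGraph V} {L : Sym2 V → Finset β}
    {c : Sym2 V → β} {v1 v2 v3 v4 u1 u2 u3 u4 : V}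

lemma NoCh.rot (N : NoCh v1 v2 v3 v4 u1 u2 u3 u4) : NoCh v2 v3 v4 v1 u2 u3 u4 u1 :=
  ⟨N.c24, N.c42, N.c31, N.c13⟩

lemma NoCh.refl (N : NoCh v1 v2 v3 v4 u1 u2 u3 u4) : NoCh v1 v4 v3 v2 u1 u4 u3 u2 :=
  ⟨N.c13, N.c31, N.c42, N.c24⟩

lemma caseEq (X : Ctx G L c v1 v2 v3 v4 u1 u2 u3 u4) (N : NoCh v1 v2 v3 v4 u1 u2 u3 u4)
    (h1 : u1 = u3) : StronglyListColorable G L := by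
  by_cases h3 : u2 = u4
  · exact case2a2 X N h1 h3
  by_cases h4 : G.Adj u2 u4
  · by_cases h5 : G.Adj u1 u2
    · exact case2a4 X N h1 h4 h5
    by_cases h6 : G.Adj u1 u4
    · exact case2a4 X.refl N.refl h1 h4.symm h6
    exact case2a3 X N h1 h4 h5 h6
  · exact case2a1 X N h1 h3 h4

lemma caseCross (X : Ctx G L c v1 v2 v3 v4 u1 u2 u3 u4) (N : NoCh v1 v2 v3 v4 u1 u2 u3 u4)
    (h1 : G.Adj u1 u3) (h2 : G.Adj u1 u2)
    (d1 : u1 ≠ u2) (d2 : u1 ≠ u4) (d3 : u3 ≠ u2) (d4 : u3 ≠ u4) (d5 : u2 ≠ u4) :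
    StronglyListColorable G L := by
  by_cases h3 : G.Adj u3 u4
  · exact case3iib X N h1 h2 d1 d2 d3 d4 d5 h3
  · exact case3iia X N h1 h2 d1 d2 d3 d4 d5 h3

lemma caseAdj (X : Ctx G L c v1 v2 v3 v4 u1 u2 u3 u4) (N : NoCh v1 v2 v3 v4 u1 u2 u3 u4)
    (h1 : G.Adj u1 u3) (d5 : u2 ≠ u4) : StronglyListColorable G L := by
  by_cases d1 : u2 = u1
  · exact case3i X N h1 d1
  by_cases d2 : u4 = u1
  · exact case3i X.refl N.refl h1 d2
  by_cases d3 : u2 = u3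
  · exact case3i X.rot.rot.refl N.rot.rot.refl h1.symm d3
  by_cases d4 : u4 = u3
  · exact case3i X.rot.rot N.rot.rot h1.symm d4
  have d1 : u1 ≠ u2 := fun h => d1 h.symm
  have d2 : u1 ≠ u4 := fun h => d2 h.symm
  have d3 : u3 ≠ u2 := fun h => d3 h.symm
  have d4 : u3 ≠ u4 := fun h => d4 h.symm
  by_cases j1 : G.Adj u1 u2
  · exact caseCross X N h1 j1 d1 d2 d3 d4 d5
  by_cases j2 : G.Adj u1 u4
  · exact caseCross X.refl N.refl h1 j2 d2 d1 d4 d3 d5.symm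
  by_cases j3 : G.Adj u3 u2
  · exact caseCross X.rot.rot.refl N.rot.rot.refl h1.symm j3 d3 d4 d1 d2 d5
  by_cases j4 : G.Adj u3 u4
  · exact caseCross X.rot.rot N.rot.rot h1.symm j4 d4 d3 d2 d1 d5.symm
  by_cases h4 : G.Adj u2 u4
  · exact case3iii X N h1 h4 d1 d2 d3 d4 d5 j1 j2 j3 j4
  · exact case3iv X N h1 h4 d1 d2 d3 d4 d5 j1 j2 j3 j4

lemma caseNoCh (X : Ctx G L c v1 v2 v3 v4 u1 u2 u3 u4) (N : NoCh v1 v2 v3 v4 u1 u2 u3 u4) :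
    StronglyListColorable G L := by
  by_cases h1 : u1 = u3
  · exact caseEq X N h1
  by_cases h2 : u2 = u4
  · exact caseEq X.rot N.rot h2
  by_cases h3 : G.Adj u1 u3
  · exact caseAdj X N h3 h2
  by_cases h4 : G.Adj u2 u4
  · exact caseAdj X.rot N.rot h4 (fun h => h1 h.symm)
  exact case1 X N h1 h3 h2 h4

lemma Ctx.ch (X : Ctx G L c v1 v2 v3 v4 u1 u2 u3 u4) (h : u1 = v3) : u3 = v1 := by
  subst h
  rcases X.C.p1 with h | h
  · rcases X.C.b3 _ h.symm with h | h | h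
    · exact absurd h X.C.ne.1
    · exact absurd h.symm X.C.ne.2.2.2
    · exact h.symm
  · exact absurd h.symm X.C.n13

lemma caseCh (X : Ctx G L c v1 v2 v3 v4 u1 u2 u3 u4) (h : u1 = v3) :
    StronglyListColorable G L := by
  by_cases h2 : u2 = v4
  · exact caseCh2 X h (X.ch h) h2 (X.rot.ch h2)
  · exact caseCh1 X h (X.ch h) h2 (fun h4 => h2 (X.rot.rot.rot.ch h4))

lemma Ctx.main (X : Ctx G L c v1 v2 v3 v4 u1 u2 u3 u4) : StronglyListColorable G L := by
  by_cases h1 : u1 = v3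
  · exact caseCh X h1
  by_cases h2 : u2 = v4
  · exact caseCh X.rot h2
  by_cases h3 : u3 = v1
  · exact caseCh X.rot.rot h3
  by_cases h4 : u4 = v2
  · exact caseCh X.rot.rot.rot h4
  exact caseNoCh X ⟨h1, h3, h2, h4⟩

end

section
variable {V : Type*} [Fintype V] {G : SimpleGraph V}

lemma deg_D3 [DecidableRel G.Adj] (hd : ∀ a, (G.neighborFinset a).card ≤ 3) (a p q r : V)
    (hp : G.Adj a p) (hq : G.Adj a q)
    (hr : G.Adj a r) (h1 : p ≠ q) (h2 : p ≠ r) (h3 : q ≠ r) : nb G a p q r := by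
  classical
  intro w hw
  have hs : ({p, q, r} : Finset V) ⊆ G.neighborFinset a := by
    intro z hz
    simp only [Finset.mem_insert, Finset.mem_singleton] at hz
    rw [SimpleGraph.mem_neighborFinset]
    rcases hz with rfl | rfl | rfl <;> assumption
  have he := Finset.eq_of_subset_of_card_le hs
    (by rw [Finset.card_eq_three.2 ⟨p, q, r, h1, h2, h3, rfl⟩]; exact hd a)
  have : w ∈ ({p, q, r} : Finset V) := by
    rw [he, SimpleGraph.mem_neighborFinset]; exact hw
  simpa using this

lemma deg_D2 [DecidableRel G.Adj] (hd : ∀ a, (G.neighborFinset a).card ≤ 3) (a p q : V)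
    (hp : G.Adj a p) (hq : G.Adj a q) (h1 : p ≠ q) :
    ∃ r, nb G a p q r ∧ (G.Adj a r ∨ r = a) ∧ r ≠ p ∧ r ≠ q := by
  by_cases h : ∃ r, G.Adj a r ∧ r ≠ p ∧ r ≠ q
  · obtain ⟨r, hr, h2, h3⟩ := h
    exact ⟨r, deg_D3 hd a p q r hp hq hr h1 h2.symm h3.symm, Or.inl hr, h2, h3⟩
  · refine ⟨a, ?_, Or.inr rfl, hp.ne, hq.ne⟩
    intro w hw
    by_contra hc
    push Not at hc
    exact h ⟨w, hw, hc.1, hc.2.1⟩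

lemma deg_D1 [DecidableRel G.Adj] (hd : ∀ a, (G.neighborFinset a).card ≤ 3) (a p : V)
    (hp : G.Adj a p) : ∃ q r, nb G a p q r := by
  by_cases h : ∃ q, G.Adj a q ∧ p ≠ q
  · obtain ⟨q, hq, h1⟩ := h
    obtain ⟨r, hr, -⟩ := deg_D2 hd a p q hp hq h1
    exact ⟨q, r, hr⟩
  · refine ⟨p, p, ?_⟩
    intro w hw
    by_contra hc
    push Not at hc
    exact h ⟨w, hw, fun h => hc.1 h.symm⟩

lemma deg_K3 {β : Type*} [DecidableRel G.Adj] (hd : ∀ a, (G.neighborFinset a).card ≤ 3)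
    (U : Set (Sym2 V)) (c : Sym2 V → β) (a : V) : (Kc G U c a).card ≤ 3 := by
  have := Kc_bd (G := G) (U := U) (c := c) (w := a) (G.neighborFinset a).toList
    (fun z hz _ => by simpa using hz)
  rw [Finset.length_toList] at this
  exact this.trans (hd a)

lemma pcol_del {β : Type*} {L : Sym2 V → Finset β} {c : Sym2 V → β} (v1 v2 v3 v4 : V)
    (h1 : IsStrongEdgeColoring (G.deleteEdges (Tch v1 v2 v3 v4)) c)
    (h2 : ∀ e ∈ (G.deleteEdges (Tch v1 v2 v3 v4)).edgeSet, c e ∈ L e) :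
    PCol G L (Tch v1 v2 v3 v4) c := by
  have hm : ∀ e ∈ G.edgeSet, e ∉ Tch v1 v2 v3 v4 →
      e ∈ (G.deleteEdges (Tch v1 v2 v3 v4)).edgeSet := by
    intro e he hu
    rw [SimpleGraph.edgeSet_deleteEdges]
    exact ⟨he, hu⟩
  refine ⟨?_, fun e he hu => h2 e (hm e he hu)⟩
  intro e he f hf heU hfU hef hs
  refine h1 e (hm e he heU) f (hm f hf hfU) hef ?_
  rcases hs with ⟨v, hv1, hv2⟩ | ⟨u, v, hu, hv, ha⟩
  · exact Or.inl ⟨v, hv1, hv2⟩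
  · refine Or.inr ⟨u, v, hu, hv, ?_⟩
    rw [SimpleGraph.deleteEdges_adj]
    refine ⟨ha, ?_⟩
    intro ht
    simp only [Tch, Set.mem_ofPred_eq, Sym2.mem_iff] at ht heU hfU
    grind

end

/-- A minimal counterexample (with lists of size at least 10) has no 4-cycle. -/
theorem minimal_counterexample_no_four_cycle
    {V β : Type*} [Fintype V] (G : SimpleGraph V) [DecidableRel G.Adj]
    (hΔ : G.maxDegree ≤ 3) (L : Sym2 V → Finset β)
    (hL : ∀ e ∈ G.edgeSet, 10 ≤ (L e).card)
    (hG : ¬ StronglyListColorable G L)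
    (hmin : ∀ H : SimpleGraph V, H ≤ G → H ≠ G → StronglyListColorable H L) :
    ¬ ∃ (v : V) (c : G.Walk v v), c.IsCycle ∧ c.length = 4 := by
  classical
  rintro ⟨v, w, hw, hlen⟩
  have hd : ∀ a, (G.neighborFinset a).card ≤ 3 := fun a => by
    rw [SimpleGraph.card_neighborFinset_eq_degree]
    exact (G.degree_le_maxDegree a).trans hΔ
  obtain ⟨v1, v2, v3, v4, a12, a23, a34, a41, n13, n24⟩ : ∃ v1 v2 v3 v4, G.Adj v1 v2 ∧
      G.Adj v2 v3 ∧ G.Adj v3 v4 ∧ G.Adj v4 v1 ∧ v1 ≠ v3 ∧ v2 ≠ v4 := by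
    have hnd := hw.support_nodup
    match w, hlen, hnd with
    | .cons (v := b) h1 (.cons (v := c) h2 (.cons (v := d) h3 (.cons h4 .nil))), _, hnd =>
      refine ⟨_, _, _, _, h1, h2, h3, h4, ?_, ?_⟩
      · simp at hnd
        grind
      · simp at hnd
        grind
  have hne : G.deleteEdges (Tch v1 v2 v3 v4) ≠ G := by
    intro h
    have := a12
    rw [← h, SimpleGraph.deleteEdges_adj] at this
    exact this.2 (by left; simp)
  obtain ⟨c, hc1, hc2⟩ := hmin _ (SimpleGraph.deleteEdges_le _) hne
  have hpc := pcol_del v1 v2 v3 v4 hc1 hc2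
  obtain ⟨u1, b1, p1, q12, q14⟩ := deg_D2 hd v1 v2 v4 a12 a41.symm n24
  obtain ⟨u2, b2, p2, q21, q23⟩ := deg_D2 hd v2 v1 v3 a12.symm a23 n13
  obtain ⟨u3, b3, p3, q32, q34⟩ := deg_D2 hd v3 v2 v4 a23.symm a34 n24
  obtain ⟨u4, b4, p4, q41, q43⟩ := deg_D2 hd v4 v1 v3 a41 a34.symm n13
  let L' : Sym2 V → Finset β := fun e => if e ∈ G.edgeSet then L e else L s(v1, v2)
  have hL' : ∀ e ∈ G.edgeSet, L' e = L e := fun e he => if_pos he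
  have X : Ctx G L' c v1 v2 v3 v4 u1 u2 u3 u4 :=
    { C := ⟨a12, a23, a34, a41, n13, n24, b1, b2, b3, b4, p1, p2, p3, p4, q12, q14, q21, q23,
        q32, q34, q41, q43⟩
      hL := by
        intro e
        by_cases he : e ∈ G.edgeSet
        · rw [hL' e he]; exact hL e he
        · simp only [L', if_neg he]; exact hL _ a12
      pc := ⟨hpc.1, fun e he hu => by rw [hL' e he]; exact hpc.2 e he hu⟩
      D1 := deg_D1 hd
      D2 := deg_D2 hd
      D3 := deg_D3 hd
      K3 := deg_K3 hd }
  obtain ⟨d, hd1, hd2⟩ := X.main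
  exact hG ⟨d, hd1, fun e he => by rw [← hL' e he]; exact hd2 e he⟩
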